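/- arXiv:1402.4790 — 2 statements merged into one kernel-verified Lean document; each statement's English description precedes it below -/
import Mathlib

section
/- Let m, n, p, q be positive integers, let D be an EAS division ring, and let φ : M_{m×n}(D) → M_{p×q}(D) be an adjacency preserver. Then φ is either degenerate or standard. -/
open Matrix

variable {D : Type*} [DivisionRing D]

/-- The rank of a matrix over a division ring: the dimension of its row space,
i.e. of the left `D`-subspace of `D^n` spanned by the rows. -/
noncomputable def rowRank {m n : ℕ} (A : Matrix (Fin m) (Fin n) D) : ℕ :=
  Module.finrank D (Submodule.span D (Set.range fun i => A i))

/-- Two matrices are adjacent if their difference has rank one. -/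
def Adjacent {m n : ℕ} (A B : Matrix (Fin m) (Fin n) D) : Prop :=
  rowRank (A - B) = 1

/-- `R(x)`: the set of matrices of the form `ᵗu x` for a fixed row vector `x`. -/
def Rvec {m n : ℕ} (x : Fin n → D) : Set (Matrix (Fin m) (Fin n) D) :=
  { M | ∃ u : Fin m → D, ∀ i j, M i j = u i * x j }

/-- `L(ᵗy)`: the set of matrices of the form `ᵗy v` for a fixed column vector `ᵗy`. -/
def Lvec {m n : ℕ} (y : Fin m → D) : Set (Matrix (Fin m) (Fin n) D) :=
  { M | ∃ v : Fin n → D, ∀ i j, M i j = y i * v j }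

/-- `R_d`: the matrices whose row space is contained in `d`. -/
def Rsub {m n : ℕ} (d : Submodule D (Fin n → D)) : Set (Matrix (Fin m) (Fin n) D) :=
  { M | ∀ i, M i ∈ d }

/-- `L_e`: the matrices whose column space (a right subspace, i.e. a `Dᵐᵒᵖ`-submodule)
is contained in `e`. -/
def Lsub {m n : ℕ} (e : Submodule Dᵐᵒᵖ (Fin m → D)) : Set (Matrix (Fin m) (Fin n) D) :=
  { M | ∀ j, (fun i => M i j) ∈ e }

/-- The orthogonal set of a set `e` of column vectors. -/
def perpSet {m : ℕ} (e : Set (Fin m → D)) : Set (Fin m → D) :=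
  { u | ∀ v ∈ e, ∑ i, u i * v i = 0 }

/-- The `p × q` matrix with upper-left block `B` and zeros elsewhere. -/
def pad {m n : ℕ} (p q : ℕ) (B : Matrix (Fin m) (Fin n) D) :
    Matrix (Fin p) (Fin q) D :=
  Matrix.of fun i j =>
    if hi : (i : ℕ) < m then if hj : (j : ℕ) < n then B ⟨i, hi⟩ ⟨j, hj⟩ else 0 else 0

/-- `φ` is degenerate with respect to `A`. -/
def DegenerateAt {m n p q : ℕ} (φ : Matrix (Fin m) (Fin n) D → Matrix (Fin p) (Fin q) D)
    (A : Matrix (Fin m) (Fin n) D) : Prop :=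
  ∃ x : Fin p → D, x ≠ 0 ∧ ∃ y : Fin q → D, y ≠ 0 ∧
    ∀ M : Matrix (Fin m) (Fin n) D, rowRank M ≤ 1 →
      φ (A + M) - φ A ∈ Rvec y ∪ Lvec x

/-- `φ` is degenerate: degenerate with respect to every matrix. -/
def Degenerate {m n p q : ℕ} (φ : Matrix (Fin m) (Fin n) D → Matrix (Fin p) (Fin q) D) :
    Prop :=
  ∀ A, DegenerateAt φ A

/-- A map (sending `0` to `0`) is degenerate with respect to `0` iff it maps every matrix of
rank at most one into `R(y) ∪ L(ᵗx)` for some nonzero `y`, `x`. -/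
def DegZero {m n p q : ℕ} (φ : Matrix (Fin m) (Fin n) D → Matrix (Fin p) (Fin q) D) :
    Prop :=
  ∃ x : Fin p → D, x ≠ 0 ∧ ∃ y : Fin q → D, y ≠ 0 ∧
    ∀ M : Matrix (Fin m) (Fin n) D, rowRank M ≤ 1 → φ M ∈ Rvec y ∪ Lvec x

/-- A standard adjacency preserver. -/
def Standard {m n p q : ℕ} (φ : Matrix (Fin m) (Fin n) D → Matrix (Fin p) (Fin q) D) :
    Prop :=
  (m ≤ p ∧ n ≤ q ∧ ∃ τ : D ≃+* D, ∃ T : Matrix (Fin p) (Fin p) D,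
    ∃ S : Matrix (Fin q) (Fin q) D, ∃ R : Matrix (Fin p) (Fin q) D,
    IsUnit T ∧ IsUnit S ∧ ∀ A, φ A = T * pad p q (A.map τ) * S + R) ∨
  (n ≤ p ∧ m ≤ q ∧ ∃ σ : D → D, Function.Bijective σ ∧ σ 1 = 1 ∧
    (∀ a b, σ (a + b) = σ a + σ b) ∧ (∀ a b, σ (a * b) = σ b * σ a) ∧
    ∃ T : Matrix (Fin p) (Fin p) D, ∃ S : Matrix (Fin q) (Fin q) D,
    ∃ R : Matrix (Fin p) (Fin q) D, IsUnit T ∧ IsUnit S ∧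
    ∀ A, φ A = T * pad p q (A.map σ).transpose * S + R)

/-- A division ring is EAS if every (unital) ring endomorphism of it is surjective. -/
def EAS (D : Type*) [DivisionRing D] : Prop :=
  ∀ f : D →+* D, Function.Surjective f

/-- A set of matrices is adjacent if any two distinct members are adjacent. -/
def IsAdjacentSet {m n : ℕ} (S : Set (Matrix (Fin m) (Fin n) D)) : Prop :=
  ∀ A ∈ S, ∀ B ∈ S, A ≠ B → Adjacent A B

namespace AdjacencyPreserver

open MulOpposite

local infix:72 "⊠" => Matrix.vecMulVec

section Parallel

variable {R V : Type*} [DivisionRing R] [AddCommGroup V] [Module R V]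

/-- `w` is a scalar multiple of `v`. -/
def Par (R : Type*) {V : Type*} [DivisionRing R] [AddCommGroup V] [Module R V] (v w : V) :
    Prop :=
  ∃ c : R, c • v = w

lemma Par.rfl' {v : V} : Par R v v := ⟨1, one_smul _ _⟩

lemma Par.zero_right (v : V) : Par R v 0 := ⟨0, zero_smul _ _⟩

lemma Par.symm {v w : V} (hw : w ≠ 0) (h : Par R v w) : Par R w v := by
  obtain ⟨c, rfl⟩ := h
  have hc : c ≠ 0 := by rintro rfl; simp at hw
  exact ⟨c⁻¹, by rw [smul_smul, inv_mul_cancel₀ hc, one_smul]⟩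

lemma Par.trans {u v w : V} (h : Par R u v) (h' : Par R v w) : Par R u w := by
  obtain ⟨c, rfl⟩ := h
  obtain ⟨d, rfl⟩ := h'
  exact ⟨d * c, mul_smul _ _ _⟩

lemma Par.smul_right {v w : V} (c : R) (h : Par R v w) : Par R v (c • w) :=
  h.trans ⟨c, rfl⟩

lemma Par.sub {u v w : V} (h : Par R u v) (h' : Par R u w) : Par R u (v - w) := by
  obtain ⟨c, rfl⟩ := h
  obtain ⟨d, rfl⟩ := h'
  exact ⟨c - d, sub_smul _ _ _⟩

lemma not_par_iff {v w : V} (hv : v ≠ 0) : ¬ Par R v w ↔ LinearIndependent R ![v, w] := by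
  rw [LinearIndependent.pair_iff' hv]
  simp [Par]

lemma eq_zero_of_not_par {v w : V} (hv : v ≠ 0) (h : ¬ Par R v w) {a b : R}
    (hab : a • v + b • w = 0) : a = 0 ∧ b = 0 :=
  LinearIndependent.pair_iff.1 ((not_par_iff hv).1 h) a b hab

lemma ne_zero_of_not_par_right {v w : V} (h : ¬ Par R v w) : w ≠ 0 := by
  rintro rfl
  exact h (Par.zero_right v)

end Parallel

section RankOne

variable {m n p q : Type*} {D K : Type*} [DivisionRing D] [DivisionRing K]

lemma tensor_eq_zero {x : p → K} {v : q → K} : x ⊠ v = 0 ↔ x = 0 ∨ v = 0 := by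
  constructor
  · intro h
    by_contra! hc
    obtain ⟨i, hi⟩ := Function.ne_iff.1 hc.1
    obtain ⟨j, hj⟩ := Function.ne_iff.1 hc.2
    exact mul_ne_zero hi hj (congrFun (congrFun h i) j)
  · rintro (rfl | rfl) <;> ext <;> simp [Matrix.vecMulVec_apply]

@[simp]
lemma zero_tensor (v : q → K) : (0 : p → K) ⊠ v = 0 := tensor_eq_zero.2 (Or.inl rfl)

@[simp]
lemma tensor_zero (x : p → K) : x ⊠ (0 : q → K) = 0 := tensor_eq_zero.2 (Or.inr rfl)

lemma op_smul_tensor (c : K) (x : p → K) (v : q → K) : (op c • x) ⊠ v = x ⊠ (c • v) := by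
  ext i j
  simp [Matrix.vecMulVec_apply, mul_assoc]

lemma smul_tensor (c : Kᵐᵒᵖ) (x : p → K) (v : q → K) : (c • x) ⊠ v = x ⊠ (unop c • v) := by
  rw [← op_smul_tensor, op_unop]

lemma exists_tensor_eq_of_par {x x' : p → K} {v v' : q → K} (hx : x ≠ 0) (hv : v ≠ 0)
    (h : Par Kᵐᵒᵖ x' x) (h' : Par K v' v) : ∃ c : K, c ≠ 0 ∧ x ⊠ v = x' ⊠ (c • v') := by
  obtain ⟨a, rfl⟩ := h
  obtain ⟨b, rfl⟩ := h'
  refine ⟨unop a * b, mul_ne_zero ?_ ?_, by rw [smul_tensor, mul_smul]⟩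
  · rintro h
    simp [(unop_eq_zero_iff a).1 h] at hx
  · rintro rfl
    simp at hv

/-- Two rank one matrices whose difference has rank at most one share a row line or a column
line. -/
lemma par_or_par {x x' z : p → K} {v v' w : q → K} (hx : x ≠ 0) (hv : v ≠ 0)
    (h : x ⊠ v - x' ⊠ v' = z ⊠ w) : Par Kᵐᵒᵖ x x' ∨ Par K v v' := by
  by_cases hp : Par K v v'
  · exact Or.inr hp
  left
  have row : ∀ i, x i • v - x' i • v' = z i • w := fun i => by
    ext j
    simpa [Matrix.vecMulVec_apply] using congrFun (congrFun h i) j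
  obtain ⟨i, hi⟩ := Function.ne_iff.1 hx
  simp only [Pi.zero_apply] at hi
  have hz : z i ≠ 0 := by
    intro hz
    have := row i
    rw [hz, zero_smul, sub_eq_add_neg, ← neg_smul] at this
    exact hi (eq_zero_of_not_par hv hp this).1
  have hw : w = ((z i)⁻¹ * x i) • v - ((z i)⁻¹ * x' i) • v' := by
    rw [mul_smul, mul_smul, ← smul_sub, row i, smul_smul, inv_mul_cancel₀ hz, one_smul]
  set α := (z i)⁻¹ * x i with hα
  set β := (z i)⁻¹ * x' i with hβ
  have hα0 : α ≠ 0 := mul_ne_zero (inv_ne_zero hz) hi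
  have key : ∀ j, x j = z j * α ∧ x' j = z j * β := fun j => by
    have := row j
    rw [hw, smul_sub, smul_smul, smul_smul, sub_eq_sub_iff_sub_eq_sub] at this
    have h2 : (x j - z j * α) • v + (z j * β - x' j) • v' = 0 := by
      rw [sub_smul, sub_smul, this]; abel
    have h3 := eq_zero_of_not_par hv hp h2
    exact ⟨sub_eq_zero.1 h3.1, (sub_eq_zero.1 h3.2).symm⟩
  refine ⟨op (α⁻¹ * β), ?_⟩
  ext j
  simp only [Pi.smul_apply, op_smul_eq_mul]
  rw [(key j).1, (key j).2, mul_assoc, mul_inv_cancel_left₀ hα0]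

/-- `A - B` has rank one. -/
def Adj (A B : Matrix m n D) : Prop :=
  ∃ x : m → D, ∃ v : n → D, x ≠ 0 ∧ v ≠ 0 ∧ A - B = x ⊠ v

lemma Adj.ne {A B : Matrix m n D} (h : Adj A B) : A ≠ B := by
  rintro rfl
  obtain ⟨x, v, hx, hv, h⟩ := h
  rw [sub_self, eq_comm, tensor_eq_zero] at h
  tauto

lemma Adj.par_or_par {x x' : p → K} {v v' : q → K} (hx : x ≠ 0) (hv : v ≠ 0)
    (h : Adj (x ⊠ v) (x' ⊠ v')) : Par Kᵐᵒᵖ x x' ∨ Par K v v' := by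
  obtain ⟨z, w, -, -, h⟩ := h
  exact AdjacencyPreserver.par_or_par hx hv h

lemma Adj.symm {A B : Matrix m n D} (h : Adj A B) : Adj B A := by
  obtain ⟨x, v, hx, hv, h⟩ := h
  exact ⟨-x, v, neg_ne_zero.2 hx, hv, by rw [Matrix.neg_vecMulVec, ← h, neg_sub]⟩

lemma adj_of_sub_eq {A B : Matrix m n D} {x : m → D} {v : n → D} (hx : x ≠ 0) (hv : v ≠ 0)
    (h : A - B = x ⊠ v) : Adj A B := ⟨x, v, hx, hv, h⟩

lemma tensor_injective_right {x : m → D} (hx : x ≠ 0) {v w : n → D} (h : x ⊠ v = x ⊠ w) :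
    v = w := by
  rw [← sub_eq_zero, ← Matrix.vecMulVec_sub, tensor_eq_zero] at h
  exact sub_eq_zero.1 (h.resolve_left hx)

lemma tensor_injective_left {x y : m → D} {v : n → D} (hv : v ≠ 0) (h : x ⊠ v = y ⊠ v) :
    x = y := by
  rw [← sub_eq_zero, ← Matrix.sub_vecMulVec, tensor_eq_zero] at h
  exact sub_eq_zero.1 (h.resolve_right hv)

/-- A nonzero element of two column lines. -/
lemma par_of_tensor_eq {x x' : p → K} {v v' : q → K} (hx : x ≠ 0) (hv : v ≠ 0)
    (h : x ⊠ v = x' ⊠ v') : Par Kᵐᵒᵖ x' x ∧ Par K v' v := by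
  have h0 : x ⊠ v ≠ 0 := by simp [tensor_eq_zero, hx, hv]
  have h0' : x' ≠ 0 ∧ v' ≠ 0 := by
    rw [h, Ne, tensor_eq_zero] at h0
    tauto
  constructor
  · obtain ⟨j, hj⟩ := Function.ne_iff.1 hv
    refine ⟨op (v' j * (v j)⁻¹), ?_⟩
    ext i
    have := congrFun (congrFun h i) j
    simp only [Matrix.vecMulVec_apply] at this
    simp only [Pi.smul_apply, op_smul_eq_mul]
    rw [← mul_assoc, ← this, mul_inv_cancel_right₀ hj]
  · obtain ⟨i, hi⟩ := Function.ne_iff.1 hx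
    refine ⟨(x i)⁻¹ * x' i, ?_⟩
    ext j
    have := congrFun (congrFun h i) j
    simp only [Matrix.vecMulVec_apply] at this
    simp only [Pi.smul_apply, smul_eq_mul]
    rw [mul_assoc, ← this, inv_mul_cancel_left₀ hi]

/-- Maps preserving adjacency in one direction. -/
def Preserves (φ : Matrix m n D → Matrix p q K) : Prop :=
  ∀ A B, Adj A B → Adj (φ A) (φ B)

/-- The map `φ` seen from the base point `A`. -/
def shift (φ : Matrix m n D → Matrix p q K) (A : Matrix m n D) :
    Matrix m n D → Matrix p q K :=
  fun M => φ (A + M) - φ A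

lemma shift_zero (φ : Matrix m n D → Matrix p q K) (A : Matrix m n D) : shift φ A 0 = 0 := by
  simp [shift]

lemma shift_shift (φ : Matrix m n D → Matrix p q K) (A B : Matrix m n D) :
    shift (shift φ A) B = shift φ (A + B) := by
  ext M : 1
  simp [shift, add_assoc]

lemma Preserves.shift {φ : Matrix m n D → Matrix p q K} (h : Preserves φ)
    (A : Matrix m n D) : Preserves (shift φ A) := by
  intro B C hBC
  obtain ⟨x, v, hx, hv, e⟩ := hBC
  have := h (A + B) (A + C) ⟨x, v, hx, hv, by rw [← e]; abel⟩
  obtain ⟨x, v, hx, hv, e⟩ := this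
  exact ⟨x, v, hx, hv, by rw [← e]; simp [AdjacencyPreserver.shift]⟩

end RankOne

section Combinatorics

lemma total_of_or {α U W : Type*} (f : α → U) (g : α → W) (h : ∀ a b, f a = f b ∨ g a = g b) :
    (∀ a b, f a = f b) ∨ (∀ a b, g a = g b) := by
  by_contra! hc
  obtain ⟨⟨a, b, hab⟩, ⟨c, d, hcd⟩⟩ := hc
  have h1 := (h a b).resolve_left hab
  have h2 := (h c d).resolve_right hcd
  rcases h a c with e | e
  · rcases h b c with e' | e'
    · exact hab (e.trans e'.symm)
    · rcases h a d with e2 | e2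
      · rcases h b d with e3 | e3
        · exact hab (e2.trans e3.symm)
        · exact hcd (e'.symm.trans e3)
      · exact hcd (e'.symm.trans (h1.symm.trans e2))
  · rcases h a d with e' | e'
    · rcases h b d with e2 | e2
      · exact hab (e'.trans e2.symm)
      · exact hcd (e.symm.trans (h1.trans e2))
    · exact hcd (e.symm.trans e')

/-- A map between grids sending every line into a line either sends everything into the union
of a row and a column, or is a product map, possibly after exchanging the coordinates. -/
lemma grid_map_cases {X Y U W : Type*} [Nonempty X] [Nonempty Y] (α : X → Y → U)
    (β : X → Y → W) (hrow : ∀ x y y', α x y = α x y' ∨ β x y = β x y')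
    (hcol : ∀ x x' y, α x y = α x' y ∨ β x y = β x' y) :
    (∃ u w, ∀ x y, α x y = u ∨ β x y = w) ∨
    (∃ f : X → U, ∃ g : Y → W, ∀ x y, α x y = f x ∧ β x y = g y) ∨
    (∃ f : X → W, ∃ g : Y → U, ∀ x y, α x y = g y ∧ β x y = f x) := by
  obtain ⟨x₀⟩ := ‹Nonempty X›
  obtain ⟨y₀⟩ := ‹Nonempty Y›
  have row : ∀ x, (∀ y y', α x y = α x y') ∨ (∀ y y', β x y = β x y') :=
    fun x => total_of_or _ _ (hrow x)
  have col : ∀ y, (∀ x x', α x y = α x' y) ∨ (∀ x x', β x y = β x' y) :=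
    fun y => total_of_or (fun x => α x y) (fun x => β x y) fun x x' => hcol x x' y
  have mixed {U W : Type _} (α : X → Y → U) (β : X → Y → W)
      (row : ∀ x, (∀ y y', α x y = α x y') ∨ (∀ y y', β x y = β x y'))
      (col : ∀ y, (∀ x x', α x y = α x' y) ∨ (∀ x x', β x y = β x' y))
      (hα : ¬ ∀ x y y', α x y = α x y') (hβ : ¬ ∀ x y y', β x y = β x y') :
      ∃ u w, ∀ x y, α x y = u ∨ β x y = w := by
    push Not at hα hβ
    obtain ⟨z, a, b, hab⟩ := hα
    obtain ⟨x, c, d, hcd⟩ := hβ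
    have hx := (row x).resolve_right fun h => hcd (h _ _)
    have hz := (row z).resolve_left fun h => hab (h _ _)
    refine ⟨α x y₀, β z y₀, ?_⟩
    obtain ⟨y₁, hy₁⟩ : ∃ y, β x y ≠ β z y₀ := by
      by_contra! h
      exact hcd ((h c).trans (h d).symm)
    obtain ⟨y₂, hy₂⟩ : ∃ y, α z y ≠ α x y₀ := by
      by_contra! h
      exact hab ((h a).trans (h b).symm)
    have c₁ := (col y₁).resolve_right fun h => hy₁ ((h x z).trans (hz _ _))
    have c₂ := (col y₂).resolve_left fun h => hy₂ ((h z x).trans (hx _ _))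
    intro t y
    rcases row t with h | h
    · exact Or.inl ((h y y₁).trans ((c₁ t x).trans (hx _ _)))
    · exact Or.inr ((h y y₂).trans ((c₂ t z).trans (hz _ _)))
  by_cases hα : ∀ x y y', α x y = α x y'
  · by_cases hβ : ∀ y x x', β x y = β x' y
    · exact Or.inr (Or.inl ⟨fun x => α x y₀, fun y => β x₀ y, fun x y => ⟨hα _ _ _, hβ _ _ _⟩⟩)
    · push Not at hβ
      obtain ⟨y, x, x', hxx⟩ := hβ
      have c := (col y).resolve_right fun h => hxx (h _ _)
      exact Or.inl ⟨α x₀ y, β x₀ y, fun t s => Or.inl ((hα t s y).trans (c _ _))⟩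
  by_cases hβ : ∀ x y y', β x y = β x y'
  · by_cases hα' : ∀ y x x', α x y = α x' y
    · exact Or.inr (Or.inr ⟨fun x => β x y₀, fun y => α x₀ y, fun x y => ⟨hα' _ _ _, hβ _ _ _⟩⟩)
    · push Not at hα'
      obtain ⟨y, x, x', hxx⟩ := hα'
      have c := (col y).resolve_left fun h => hxx (h _ _)
      exact Or.inl ⟨α x₀ y, β x₀ y, fun t s => Or.inr ((hβ t s y).trans (c _ _))⟩
  exact Or.inl (mixed α β row col hα hβ)

end Combinatorics

section Classification

variable {m n p q : Type*} {D K : Type*} [DivisionRing D] [DivisionRing K]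

/-- `φ` maps rank one matrices to the union of a row line and a column line. -/
def CrossLike (φ : Matrix m n D → Matrix p q K) : Prop :=
  ∃ ξ : p → K, ξ ≠ 0 ∧ ∃ η : q → K, η ≠ 0 ∧ ∀ x y,
    (∃ v, φ (x ⊠ y) = ξ ⊠ v) ∨ ∃ u, φ (x ⊠ y) = u ⊠ η

/-- On rank one matrices `φ` is a product of two nonconstant maps of projective spaces. -/
structure RegularWith (φ : Matrix m n D → Matrix p q K) (f : (m → D) → p → K)
    (g : (n → D) → q → K) : Prop where
  left_ne : ∀ x, x ≠ 0 → f x ≠ 0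
  right_ne : ∀ y, y ≠ 0 → g y ≠ 0
  eq : ∀ x y, x ≠ 0 → y ≠ 0 → ∃ c : K, c ≠ 0 ∧ φ (x ⊠ y) = f x ⊠ (c • g y)
  left_ex : ∃ x₁ x₂, x₁ ≠ 0 ∧ x₂ ≠ 0 ∧ ¬ Par Kᵐᵒᵖ (f x₁) (f x₂)
  right_ex : ∃ y₁ y₂, y₁ ≠ 0 ∧ y₂ ≠ 0 ∧ ¬ Par K (g y₁) (g y₂)

/-- As `RegularWith`, with the roles of rows and columns exchanged by `φ`. -/
structure TransRegularWith (φ : Matrix m n D → Matrix p q K) (f : (m → D) → q → K)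
    (g : (n → D) → p → K) : Prop where
  left_ne : ∀ x, x ≠ 0 → f x ≠ 0
  right_ne : ∀ y, y ≠ 0 → g y ≠ 0
  eq : ∀ x y, x ≠ 0 → y ≠ 0 → ∃ c : K, c ≠ 0 ∧ φ (x ⊠ y) = g y ⊠ (c • f x)
  left_ex : ∃ x₁ x₂, x₁ ≠ 0 ∧ x₂ ≠ 0 ∧ ¬ Par K (f x₁) (f x₂)
  right_ex : ∃ y₁ y₂, y₁ ≠ 0 ∧ y₂ ≠ 0 ∧ ¬ Par Kᵐᵒᵖ (g y₁) (g y₂)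

/-- `φ` is a product map on rank one matrices. -/
def Regular (φ : Matrix m n D → Matrix p q K) : Prop := ∃ f g, RegularWith φ f g

lemma mk_eq_mk_of_par {S W : Type*} [DivisionRing S] [AddCommGroup W] [Module S W] {v w : W}
    (hv : v ≠ 0) (hw : w ≠ 0) (h : Par S w v) :
    Projectivization.mk S v hv = Projectivization.mk S w hw :=
  (Projectivization.mk_eq_mk_iff' S v w hv hw).2 h

lemma par_rep_of_mk_eq {S W : Type*} [DivisionRing S] [AddCommGroup W] [Module S W] {v : W}
    (hv : v ≠ 0) {P : Projectivization S W} (h : Projectivization.mk S v hv = P) :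
    Par S P.rep v := by
  rw [← P.mk_rep] at h
  exact (Projectivization.mk_eq_mk_iff' S _ _ hv P.rep_nonzero).1 h

lemma exists_ne_zero_of_nonempty [Nonempty m] : ∃ x : m → D, x ≠ 0 :=
  ⟨fun _ => 1, fun h => one_ne_zero (congrFun h (Classical.arbitrary m))⟩

lemma adj_tensor_right {x : m → D} (hx : x ≠ 0) {y y' : n → D} (h : y ≠ y') :
    Adj (x ⊠ y) (x ⊠ y') :=
  ⟨x, y - y', hx, sub_ne_zero.2 h, (Matrix.vecMulVec_sub _ _ _).symm⟩

lemma adj_tensor_left {x x' : m → D} (h : x ≠ x') {y : n → D} (hy : y ≠ 0) :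
    Adj (x ⊠ y) (x' ⊠ y) :=
  ⟨x - x', y, sub_ne_zero.2 h, hy, (Matrix.sub_vecMulVec _ _ _).symm⟩

lemma Preserves.exists_tensor {φ : Matrix m n D → Matrix p q K} (h : Preserves φ)
    (h0 : φ 0 = 0) {x : m → D} {y : n → D} (hx : x ≠ 0) (hy : y ≠ 0) :
    ∃ ξ : p → K, ∃ η : q → K, ξ ≠ 0 ∧ η ≠ 0 ∧ φ (x ⊠ y) = ξ ⊠ η := by
  obtain ⟨ξ, η, a, b, e⟩ := h (x ⊠ y) 0 ⟨x, y, hx, hy, sub_zero _⟩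
  exact ⟨ξ, η, a, b, by rw [← e, h0, sub_zero]⟩

lemma Preserves.classify [Nonempty m] [Nonempty n] {φ : Matrix m n D → Matrix p q K}
    (h : Preserves φ) (h0 : φ 0 = 0) :
    CrossLike φ ∨ Regular φ ∨ ∃ f g, TransRegularWith φ f g := by
  classical
  obtain ⟨x₀, hx₀⟩ := exists_ne_zero_of_nonempty (m := m) (D := D)
  obtain ⟨y₀, hy₀⟩ := exists_ne_zero_of_nonempty (m := n) (D := D)
  have hne : ∀ (x : {x : m → D // x ≠ 0}) (y : {y : n → D // y ≠ 0}),
      ∃ ξ : p → K, ∃ η : q → K, ξ ≠ 0 ∧ η ≠ 0 ∧ φ (x.1 ⊠ y.1) = ξ ⊠ η :=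
    fun x y => h.exists_tensor h0 x.2 y.2
  choose ξ η hξ hη e using hne
  have : Nonempty {x : m → D // x ≠ 0} := ⟨⟨x₀, hx₀⟩⟩
  have : Nonempty {y : n → D // y ≠ 0} := ⟨⟨y₀, hy₀⟩⟩
  have key : ∀ x x' y y', φ (x.1 ⊠ y.1) = φ (x'.1 ⊠ y'.1) ∨
      Adj (φ (x.1 ⊠ y.1)) (φ (x'.1 ⊠ y'.1)) →
      Projectivization.mk Kᵐᵒᵖ (ξ x y) (hξ x y) = Projectivization.mk _ _ (hξ x' y') ∨
      Projectivization.mk K (η x y) (hη x y) = Projectivization.mk _ _ (hη x' y') := by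
    intro x x' y y' hA
    rw [e, e] at hA
    rcases hA with hA | hA
    · exact Or.inl (mk_eq_mk_of_par _ _ (par_of_tensor_eq (hξ _ _) (hη _ _) hA).1)
    · rcases hA.par_or_par (hξ _ _) (hη _ _) with hA | hA
      · exact Or.inl (mk_eq_mk_of_par _ _ (hA.symm (hξ _ _)))
      · exact Or.inr (mk_eq_mk_of_par _ _ (hA.symm (hη _ _)))
  have hcross : (∃ u w, ∀ x y, (u : p → K) ≠ 0 ∧ (w : q → K) ≠ 0 ∧
      (Par Kᵐᵒᵖ u (ξ x y) ∨ Par K w (η x y))) → CrossLike φ := by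
    rintro ⟨u, w, H⟩
    obtain ⟨hu, hw, -⟩ := H ⟨x₀, hx₀⟩ ⟨y₀, hy₀⟩
    refine ⟨u, hu, w, hw, fun x y => ?_⟩
    by_cases hx : x = 0
    · exact Or.inl ⟨0, by simp [hx, h0]⟩
    by_cases hy : y = 0
    · exact Or.inl ⟨0, by simp [hy, h0]⟩
    have e' : φ (x ⊠ y) = _ := e ⟨x, hx⟩ ⟨y, hy⟩
    obtain ⟨-, -, H | H⟩ := H ⟨x, hx⟩ ⟨y, hy⟩
    · obtain ⟨c, hc⟩ := H
      exact Or.inl ⟨unop c • η ⟨x, hx⟩ ⟨y, hy⟩, by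
        rw [e', ← hc, smul_tensor]⟩
    · obtain ⟨c, hc⟩ := H
      exact Or.inr ⟨op c • ξ ⟨x, hx⟩ ⟨y, hy⟩, by rw [e', ← hc, op_smul_tensor]⟩
  rcases grid_map_cases (fun x y => Projectivization.mk Kᵐᵒᵖ (ξ x y) (hξ x y))
    (fun x y => Projectivization.mk K (η x y) (hη x y))
    (fun x y y' => key x x y y' (by
      by_cases hyy : y.1 = y'.1
      · exact Or.inl (by rw [hyy])
      · exact Or.inr (h _ _ (adj_tensor_right x.2 hyy))))
    (fun x x' y => key x x' y y (by
      by_cases hxx : x.1 = x'.1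
      · exact Or.inl (by rw [hxx])
      · exact Or.inr (h _ _ (adj_tensor_left hxx y.2)))) with
    ⟨u, w, H⟩ | ⟨f, g, H⟩ | ⟨f, g, H⟩
  · refine Or.inl (hcross ⟨u.rep, w.rep, fun x y => ⟨u.rep_nonzero, w.rep_nonzero, ?_⟩⟩)
    exact (H x y).imp (par_rep_of_mk_eq _) (par_rep_of_mk_eq _)
  · by_cases hf : ∃ x₁ x₂, ¬ Par Kᵐᵒᵖ (f x₁).rep (f x₂).rep
    · by_cases hg : ∃ y₁ y₂, ¬ Par K (g y₁).rep (g y₂).rep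
      · right; left
        obtain ⟨x₁, x₂, hf⟩ := hf
        obtain ⟨y₁, y₂, hg⟩ := hg
        refine ⟨fun x => if h : x ≠ 0 then (f ⟨x, h⟩).rep else 0,
          fun x => if h : x ≠ 0 then (g ⟨x, h⟩).rep else 0, ⟨?_, ?_, ?_, ?_, ?_⟩⟩
        · intro x hx
          simpa [hx] using (f ⟨x, hx⟩).rep_nonzero
        · intro x hx
          simpa [hx] using (g ⟨x, hx⟩).rep_nonzero
        · intro x y hx hy
          simp only [ne_eq, hx, not_false_eq_true, dite_true, hy]
          rw [e ⟨x, hx⟩ ⟨y, hy⟩]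
          exact exists_tensor_eq_of_par (hξ _ _) (hη _ _) (par_rep_of_mk_eq _ (H _ _).1)
            (par_rep_of_mk_eq _ (H _ _).2)
        · exact ⟨x₁, x₂, x₁.2, x₂.2, by simpa [x₁.2, x₂.2] using hf⟩
        · exact ⟨y₁, y₂, y₁.2, y₂.2, by simpa [y₁.2, y₂.2] using hg⟩
      · push Not at hg
        refine Or.inl (hcross ⟨(f ⟨x₀, hx₀⟩).rep, (g ⟨y₀, hy₀⟩).rep, fun x y =>
          ⟨Projectivization.rep_nonzero _, Projectivization.rep_nonzero _, Or.inr ?_⟩⟩)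
        exact (hg _ y).trans (par_rep_of_mk_eq _ (H x y).2)
    · push Not at hf
      refine Or.inl (hcross ⟨(f ⟨x₀, hx₀⟩).rep, (g ⟨y₀, hy₀⟩).rep, fun x y =>
        ⟨Projectivization.rep_nonzero _, Projectivization.rep_nonzero _, Or.inl ?_⟩⟩)
      exact (hf _ x).trans (par_rep_of_mk_eq _ (H x y).1)
  · by_cases hf : ∃ x₁ x₂, ¬ Par K (f x₁).rep (f x₂).rep
    · by_cases hg : ∃ y₁ y₂, ¬ Par Kᵐᵒᵖ (g y₁).rep (g y₂).rep
      · right; right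
        obtain ⟨x₁, x₂, hf⟩ := hf
        obtain ⟨y₁, y₂, hg⟩ := hg
        refine ⟨fun x => if h : x ≠ 0 then (f ⟨x, h⟩).rep else 0,
          fun x => if h : x ≠ 0 then (g ⟨x, h⟩).rep else 0, ⟨?_, ?_, ?_, ?_, ?_⟩⟩
        · intro x hx
          simpa [hx] using (f ⟨x, hx⟩).rep_nonzero
        · intro x hx
          simpa [hx] using (g ⟨x, hx⟩).rep_nonzero
        · intro x y hx hy
          simp only [ne_eq, hx, not_false_eq_true, dite_true, hy]
          rw [e ⟨x, hx⟩ ⟨y, hy⟩]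
          exact exists_tensor_eq_of_par (hξ _ _) (hη _ _) (par_rep_of_mk_eq _ (H _ _).1)
            (par_rep_of_mk_eq _ (H _ _).2)
        · exact ⟨x₁, x₂, x₁.2, x₂.2, by simpa [x₁.2, x₂.2] using hf⟩
        · exact ⟨y₁, y₂, y₁.2, y₂.2, by simpa [y₁.2, y₂.2] using hg⟩
      · push Not at hg
        refine Or.inl (hcross ⟨(g ⟨y₀, hy₀⟩).rep, (f ⟨x₀, hx₀⟩).rep, fun x y =>
          ⟨Projectivization.rep_nonzero _, Projectivization.rep_nonzero _, Or.inl ?_⟩⟩)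
        exact (hg _ y).trans (par_rep_of_mk_eq _ (H x y).1)
    · push Not at hf
      refine Or.inl (hcross ⟨(g ⟨y₀, hy₀⟩).rep, (f ⟨x₀, hx₀⟩).rep, fun x y =>
        ⟨Projectivization.rep_nonzero _, Projectivization.rep_nonzero _, Or.inr ?_⟩⟩)
      exact (hf _ x).trans (par_rep_of_mk_eq _ (H x y).2)

end Classification

section Propagation

variable {m n p q : Type*} {D K : Type*} [DivisionRing D] [DivisionRing K]

lemma exists_not_par {R V : Type*} [DivisionRing R] [AddCommGroup V] [Module R V] {v a b : V}
    (ha : a ≠ 0) (h : ¬ Par R a b) : ¬ Par R v a ∨ ¬ Par R v b := by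
  by_contra! hc
  exact h ((hc.1.symm ha).trans hc.2)

lemma par_smul_iff {R V : Type*} [DivisionRing R] [AddCommGroup V] [Module R V] {v w : V}
    {c : R} (hc : c ≠ 0) : Par R (c • v) w ↔ Par R v w := by
  constructor
  · rintro ⟨d, rfl⟩
    exact ⟨d * c, mul_smul _ _ _⟩
  · rintro ⟨d, rfl⟩
    exact ⟨d * c⁻¹, by rw [smul_smul, mul_assoc, inv_mul_cancel₀ hc, mul_one]⟩

lemma par_smul_right_iff {R V : Type*} [DivisionRing R] [AddCommGroup V] [Module R V] {v w : V}
    {c : R} (hc : c ≠ 0) : Par R v (c • w) ↔ Par R v w := by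
  constructor
  · rintro ⟨d, h⟩
    exact ⟨c⁻¹ * d, by rw [mul_smul, h, smul_smul, inv_mul_cancel₀ hc, one_smul]⟩
  · exact Par.smul_right c

lemma RegularWith.exists_left {φ : Matrix m n D → Matrix p q K} {f : (m → D) → p → K}
    {g : (n → D) → q → K} (R : RegularWith φ f g) (x₁ : m → D) :
    ∃ x₂, x₂ ≠ 0 ∧ ¬ Par Kᵐᵒᵖ (f x₁) (f x₂) := by
  obtain ⟨a, b, ha, hb, h⟩ := R.left_ex
  rcases exists_not_par (v := f x₁) (R.left_ne a ha) h with h | h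
  exacts [⟨a, ha, h⟩, ⟨b, hb, h⟩]

lemma RegularWith.exists_right {φ : Matrix m n D → Matrix p q K} {f : (m → D) → p → K}
    {g : (n → D) → q → K} (R : RegularWith φ f g) (y₁ : n → D) :
    ∃ y₂, y₂ ≠ 0 ∧ ¬ Par K (g y₁) (g y₂) := by
  obtain ⟨a, b, ha, hb, h⟩ := R.right_ex
  rcases exists_not_par (v := g y₁) (R.right_ne a ha) h with h | h
  exacts [⟨a, ha, h⟩, ⟨b, hb, h⟩]

lemma RegularWith.par_left {φ : Matrix m n D → Matrix p q K} {f : (m → D) → p → K}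
    {g : (n → D) → q → K} (R : RegularWith φ f g) [Nonempty n] {x : m → D} (hx : x ≠ 0)
    {c : Dᵐᵒᵖ} (hc : c ≠ 0) : Par Kᵐᵒᵖ (f x) (f (c • x)) := by
  obtain ⟨y, hy⟩ := exists_ne_zero_of_nonempty (m := n) (D := D)
  have hc' : unop c ≠ 0 := fun h => hc ((unop_eq_zero_iff c).1 h)
  have hcx : c • x ≠ 0 := smul_ne_zero hc hx
  obtain ⟨a, ha, h1⟩ := R.eq (c • x) y hcx hy
  obtain ⟨b, hb, h2⟩ := R.eq x (unop c • y) hx (smul_ne_zero hc' hy)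
  rw [← smul_tensor, h1] at h2
  exact (par_of_tensor_eq (R.left_ne _ hcx) (smul_ne_zero ha (R.right_ne _ hy)) h2).1

lemma RegularWith.par_right {φ : Matrix m n D → Matrix p q K} {f : (m → D) → p → K}
    {g : (n → D) → q → K} (R : RegularWith φ f g) [Nonempty m] {y : n → D} (hy : y ≠ 0)
    {c : D} (hc : c ≠ 0) : Par K (g y) (g (c • y)) := by
  obtain ⟨x, hx⟩ := exists_ne_zero_of_nonempty (m := m) (D := D)
  have hcx : op c • x ≠ 0 := smul_ne_zero (by simpa using hc) hx
  obtain ⟨a, ha, h1⟩ := R.eq (op c • x) y hcx hy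
  obtain ⟨b, hb, h2⟩ := R.eq x (c • y) hx (smul_ne_zero hc hy)
  rw [← op_smul_tensor, h1] at h2
  have := (par_of_tensor_eq (R.left_ne _ hx)
    (smul_ne_zero hb (R.right_ne _ (smul_ne_zero hc hy))) h2.symm).2
  rwa [par_smul_iff ha, par_smul_right_iff hb] at this

lemma RegularWith.not_par_left {φ : Matrix m n D → Matrix p q K} {f : (m → D) → p → K}
    {g : (n → D) → q → K} (R : RegularWith φ f g) [Nonempty n] {x x' : m → D} (hx : x ≠ 0)
    (hx' : x' ≠ 0) (h : ¬ Par Kᵐᵒᵖ (f x) (f x')) : ¬ Par Dᵐᵒᵖ x x' := by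
  rintro ⟨c, rfl⟩
  exact h (R.par_left hx fun hc => hx' (by rw [hc, zero_smul]))

lemma RegularWith.not_par_right {φ : Matrix m n D → Matrix p q K} {f : (m → D) → p → K}
    {g : (n → D) → q → K} (R : RegularWith φ f g) [Nonempty m] {y y' : n → D} (hy : y ≠ 0)
    (hy' : y' ≠ 0) (h : ¬ Par K (g y) (g y')) : ¬ Par D y y' := by
  rintro ⟨c, rfl⟩
  exact h (R.par_right hy fun hc => hy' (by rw [hc, zero_smul]))

/-- If near `x₁ ⊠ y₁` the map `φ` takes values in the cross through `f x₁` and `g y₁`, then a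
matrix adjacent to enough rank one matrices is mapped to a multiple of `f x₁ ⊠ g y₁`. -/
lemma RegularWith.corner {φ : Matrix m n D → Matrix p q K} {f : (m → D) → p → K}
    {g : (n → D) → q → K} (R : RegularWith φ f g) (hφ : Preserves φ) {x₁ x' : m → D}
    {y₁ y' : n → D} (hx₁ : x₁ ≠ 0) (hy₁ : y₁ ≠ 0) (hx' : x' ≠ 0) (hy' : y' ≠ 0)
    {B : Matrix m n D}
    (H : (∃ v, φ B = f x₁ ⊠ v) ∨ ∃ u, φ B = u ⊠ g y₁)
    (hf : ¬ Par Kᵐᵒᵖ (f x₁) (f x')) (hg : ¬ Par K (g y₁) (g y'))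
    (h1 : Adj (x₁ ⊠ y') B) (h2 : Adj (x' ⊠ y₁) B) :
    ∃ k : K, φ B = f x₁ ⊠ (k • g y₁) := by
  have k1 := R.left_ne _ hx₁
  have k2 := R.right_ne _ hy₁
  have k3 := R.left_ne _ hx'
  have k4 := R.right_ne _ hy'
  rcases H with ⟨v, hv⟩ | ⟨u, hu⟩
  · by_cases hv0 : v = 0
    · exact ⟨0, by rw [hv, hv0, zero_smul]⟩
    have a := hφ _ _ h2
    obtain ⟨c, hc, e⟩ := R.eq _ _ hx' hy₁
    rw [hv, e] at a
    rcases a.par_or_par k3 (smul_ne_zero hc k2) with a | a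
    · exact absurd (a.symm k1) hf
    · rw [par_smul_iff hc] at a
      obtain ⟨k, hk⟩ := a
      exact ⟨k, by rw [hk, hv]⟩
  · by_cases hu0 : u = 0
    · exact ⟨0, by rw [hu, hu0]; simp⟩
    have a := hφ _ _ h1
    obtain ⟨c, hc, e⟩ := R.eq _ _ hx₁ hy'
    rw [hu, e] at a
    rcases a.par_or_par k1 (smul_ne_zero hc k4) with ⟨k, rfl⟩ | a
    · exact ⟨unop k, by rw [hu, smul_tensor]⟩
    · rw [par_smul_iff hc] at a
      exact absurd (a.symm k2) hg

lemma RegularWith.corner_eq_zero {φ : Matrix m n D → Matrix p q K} {f : (m → D) → p → K}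
    {g : (n → D) → q → K} (R : RegularWith φ f g) (hφ : Preserves φ) {x₁ x₂ x₃ : m → D}
    {y₁ y₂ y₃ : n → D} (hx₁ : x₁ ≠ 0) (hy₁ : y₁ ≠ 0) (hx₂ : x₂ ≠ 0) (hy₂ : y₂ ≠ 0)
    (hx₃ : x₃ ≠ 0) (hy₃ : y₃ ≠ 0) {B : Matrix m n D}
    (H : (∃ v, φ B = f x₁ ⊠ v) ∨ ∃ u, φ B = u ⊠ g y₁)
    (hf : ¬ Par Kᵐᵒᵖ (f x₁) (f x₂)) (hg : ¬ Par K (g y₁) (g y₂))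
    (hf' : ¬ Par Kᵐᵒᵖ (f x₁) (f x₃)) (hg' : ¬ Par K (g y₁) (g y₃))
    (h1 : Adj (x₁ ⊠ y₂) B) (h2 : Adj (x₂ ⊠ y₁) B) (h3 : Adj (x₃ ⊠ y₃) B) : φ B = 0 := by
  obtain ⟨k, hk⟩ := R.corner hφ hx₁ hy₁ hx₂ hy₂ H hf hg h1 h2
  by_cases hk0 : k = 0
  · rw [hk, hk0, zero_smul, tensor_zero]
  exfalso
  have a := hφ _ _ h3
  obtain ⟨c, hc, e⟩ := R.eq _ _ hx₃ hy₃
  rw [hk, e] at a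
  rcases a.par_or_par (R.left_ne _ hx₃) (smul_ne_zero hc (R.right_ne _ hy₃)) with a | a
  · exact hf' (a.symm (R.left_ne _ hx₁))
  · rw [par_smul_iff hc, par_smul_right_iff hk0] at a
    exact hg' (a.symm (R.right_ne _ hy₁))

lemma smul_left_ne_zero_of_not_par {R V : Type*} [DivisionRing R] [AddCommGroup V] [Module R V]
    {v w : V} (hv : v ≠ 0) (h : ¬ Par R v w) {a b : R} (hab : a ≠ 0 ∨ b ≠ 0) :
    a • v + b • w ≠ 0 := by
  intro h0
  have := eq_zero_of_not_par hv h h0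
  tauto

/-- The cross configuration is contradictory over a division ring with a third element. -/
lemma RegularWith.false_of_cross {φ : Matrix m n D → Matrix p q K} {f : (m → D) → p → K}
    {g : (n → D) → q → K} (R : RegularWith φ f g) (hφ : Preserves φ) {x₁ : m → D}
    {y₁ : n → D} (hx₁ : x₁ ≠ 0) (hy₁ : y₁ ≠ 0)
    (H : ∀ x y, (∃ v, φ (x₁ ⊠ y₁ + x ⊠ y) = f x₁ ⊠ v) ∨
      ∃ u, φ (x₁ ⊠ y₁ + x ⊠ y) = u ⊠ g y₁) {r : D} (hr : r ≠ 0) (hr' : 1 + r ≠ 0) : False := by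
  obtain ⟨i, -⟩ := Function.ne_iff.1 hx₁
  obtain ⟨j, -⟩ := Function.ne_iff.1 hy₁
  have : Nonempty m := ⟨i⟩
  have : Nonempty n := ⟨j⟩
  obtain ⟨x₂, hx₂, hf⟩ := R.exists_left x₁
  obtain ⟨y₂, hy₂, hg⟩ := R.exists_right y₁
  have ix := R.not_par_left hx₁ hx₂ hf
  have iy := R.not_par_right hy₁ hy₂ hg
  obtain ⟨t, ht⟩ : ∃ t : D, t + t * r = r :=
    ⟨r * (1 + r)⁻¹, by rw [← mul_one_add, mul_assoc, inv_mul_cancel₀ hr', mul_one]⟩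
  have ht0 : t ≠ 0 := by
    rintro rfl
    simp [hr.symm] at ht
  have htx : ¬ Par Kᵐᵒᵖ (f x₁) (f (op t • x₂)) := fun h =>
    hf (h.trans ((R.par_left hx₂ (by simpa using ht0)).symm
      (R.left_ne _ (smul_ne_zero (by simpa using ht0) hx₂))))
  have nx : ∀ a b : D, a ≠ 0 ∨ b ≠ 0 → op a • x₁ + op b • x₂ ≠ 0 := fun a b hab =>
    smul_left_ne_zero_of_not_par hx₁ ix (by simpa using hab)
  have ny : ∀ a b : D, a ≠ 0 ∨ b ≠ 0 → a • y₁ + b • y₂ ≠ 0 := fun a b hab =>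
    smul_left_ne_zero_of_not_par hy₁ iy hab
  have htr : t * r = r - t := eq_sub_of_add_eq' ht
  have e1 : ∀ x x' : m → D, ∀ y y' : n → D, (x + x') ⊠ (y + y') =
    x ⊠ y + x ⊠ y' + x' ⊠ y + x' ⊠ y' := fun x x' y y' => by
      rw [Matrix.add_vecMulVec, Matrix.vecMulVec_add, Matrix.vecMulVec_add]; abel
  have hB : φ (x₁ ⊠ y₁ + (op r • x₁ + op (-r) • x₂) ⊠ ((1 : D) • y₁ + (-1 : D) • y₂)) = 0 := by
    refine R.corner_eq_zero hφ hx₁ hy₁ hx₂ hy₂ (smul_ne_zero (by simpa using ht0) hx₂) hy₂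
      (H _ _) hf hg htx hg ?_ ?_ ?_ <;> refine Adj.symm ?_
    · refine adj_of_sub_eq (nx (1 + r) (-r) (Or.inl hr')) (ny 1 (-1) (by simp)) ?_
      simp only [smul_tensor, unop_op, e1, add_smul, one_smul, neg_smul, Matrix.vecMulVec_add,
        Matrix.vecMulVec_neg, neg_neg]
      abel
    · refine adj_of_sub_eq (nx 1 (-1) (by simp)) (ny (1 + r) (-r) (Or.inl hr')) ?_
      simp only [smul_tensor, unop_op, e1, add_smul, one_smul, neg_smul, Matrix.vecMulVec_add,
        Matrix.vecMulVec_neg, neg_neg]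
      abel
    · refine adj_of_sub_eq (nx 1 (-t) (by simp)) (ny (1 + r) (-r) (Or.inl hr')) ?_
      simp only [smul_tensor, unop_op, e1, add_smul, one_smul, neg_smul, Matrix.vecMulVec_add,
        Matrix.vecMulVec_neg, neg_neg, smul_smul, neg_mul, one_mul, htr, sub_smul,
        Matrix.vecMulVec_sub]
      abel
  have hB' : φ (x₁ ⊠ y₁ + (op (1 + r) • x₁ + op (-r) • x₂) ⊠
      ((-1 : D) • y₁ + (1 : D) • y₂)) = 0 := by
    refine R.corner_eq_zero hφ hx₁ hy₁ (smul_ne_zero (by simpa using ht0) hx₂) hy₂ hx₂ hy₂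
      (H _ _) htx hg hf hg ?_ ?_ ?_ <;> refine Adj.symm ?_
    · refine adj_of_sub_eq (nx r (-r) (Or.inl hr)) (ny (-1) 1 (by simp)) ?_
      simp only [smul_tensor, unop_op, e1, add_smul, one_smul, neg_smul, Matrix.vecMulVec_add,
        Matrix.vecMulVec_neg, neg_neg]
      abel
    · refine adj_of_sub_eq (nx 1 (-t) (by simp)) (ny (-r) (1 + r) (Or.inr hr')) ?_
      simp only [smul_tensor, unop_op, e1, add_smul, one_smul, neg_smul, Matrix.vecMulVec_add,
        Matrix.vecMulVec_neg, neg_neg, smul_smul, neg_mul, one_mul, htr, sub_smul,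
        Matrix.vecMulVec_sub]
      abel
    · refine adj_of_sub_eq (nx 1 (-1) (by simp)) (ny (-r) (1 + r) (Or.inr hr')) ?_
      simp only [smul_tensor, unop_op, e1, add_smul, one_smul, neg_smul, Matrix.vecMulVec_add,
        Matrix.vecMulVec_neg, neg_neg]
      abel
  refine (hφ _ _ (adj_of_sub_eq (nx (1 + r + r) (-(r + r)) ?_) (ny 1 (-1) (by simp)) ?_)).ne
    (hB.trans hB'.symm)
  · by_contra! h
    have h2 : r + r = 0 := neg_eq_zero.1 h.2
    rw [add_assoc, h2, add_zero] at h
    exact one_ne_zero h.1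
  · simp only [smul_tensor, unop_op, e1, add_smul, one_smul, neg_smul, Matrix.vecMulVec_add,
      Matrix.vecMulVec_neg, neg_neg, neg_add]
    abel

lemma neg_eq_of_two {M : Type*} [AddCommGroup M] [Module D M] (h2 : ∀ d : D, d = 0 ∨ d = 1)
    (x : M) : -x = x := by
  have : (-1 : D) = 1 := (h2 (-1)).resolve_left (by simp)
  rw [← neg_one_smul D, this, one_smul]

/-- The cross configuration is contradictory over the field with two elements. -/
lemma RegularWith.false_of_cross_of_two {φ : Matrix m n D → Matrix p q K}
    {f : (m → D) → p → K}
    {g : (n → D) → q → K} (R : RegularWith φ f g) (hφ : Preserves φ) {x₁ : m → D}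
    {y₁ : n → D} (hx₁ : x₁ ≠ 0) (hy₁ : y₁ ≠ 0)
    (H : ∀ x y, (∃ v, φ (x₁ ⊠ y₁ + x ⊠ y) = f x₁ ⊠ v) ∨
      ∃ u, φ (x₁ ⊠ y₁ + x ⊠ y) = u ⊠ g y₁) (hD : ∀ d : D, d = 0 ∨ d = 1)
    (hK : ∀ k : K, k = 0 ∨ k = 1) : False := by
  obtain ⟨i, -⟩ := Function.ne_iff.1 hx₁
  obtain ⟨j, -⟩ := Function.ne_iff.1 hy₁
  have : Nonempty m := ⟨i⟩
  have : Nonempty n := ⟨j⟩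
  obtain ⟨x₂, hx₂, hf⟩ := R.exists_left x₁
  obtain ⟨y₂, hy₂, hg⟩ := R.exists_right y₁
  have ix := R.not_par_left hx₁ hx₂ hf
  have iy := R.not_par_right hy₁ hy₂ hg
  have hx : x₁ + x₂ ≠ 0 := by
    simpa using smul_left_ne_zero_of_not_par hx₁ ix (a := 1) (b := 1) (by simp)
  have hy : y₁ + y₂ ≠ 0 := by
    simpa using smul_left_ne_zero_of_not_par hy₁ iy (a := 1) (b := 1) (by simp)
  have R' : ∀ x y, x ≠ 0 → y ≠ 0 → φ (x ⊠ y) = f x ⊠ g y := fun x y hx hy => by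
    obtain ⟨c, hc, e⟩ := R.eq x y hx hy
    rw [e, (hK c).resolve_left hc, one_smul]
  have zero_of : ∀ B, Adj B (x₁ ⊠ y₁) → (∃ k : K, φ B = f x₁ ⊠ (k • g y₁)) → φ B = 0 := by
    rintro B hB ⟨k, hk⟩
    have := (hφ _ _ hB).ne
    rw [hk, R' _ _ hx₁ hy₁] at this
    rcases hK k with rfl | rfl
    · simpa using hk
    · simp at this
  have hg' : ¬ Par K (g y₁) (g (y₁ + y₂)) := by
    rintro ⟨k, hk⟩
    rcases hK k with rfl | rfl
    · exact R.right_ne _ hy (by rw [← hk, zero_smul])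
    · have := (hφ _ _ (adj_tensor_right hx₁ (y := y₁) (y' := y₁ + y₂) (by simpa using hy₂))).ne
      rw [R' _ _ hx₁ hy₁, R' _ _ hx₁ hy, ← hk] at this
      simp at this
  have neg : ∀ M : Matrix m n D, -M = M := neg_eq_of_two hD
  have tw : ∀ M : Matrix m n D, M + M = 0 := fun M => by
    nth_rw 1 [← neg M]
    exact neg_add_cancel M
  have tw' : ∀ M N : Matrix m n D, M + (M + N) = N := fun M N => by
    rw [← add_assoc, tw, zero_add]
  have hB : φ (x₁ ⊠ y₁ + (x₁ + x₂) ⊠ (y₁ + y₂)) = 0 := by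
    refine zero_of _ (adj_of_sub_eq hx hy (add_sub_cancel_left _ _)) ?_
    refine R.corner hφ hx₁ hy₁ hx₂ hy₂ (H _ _) hf hg ?_ ?_
    · refine Adj.symm (adj_of_sub_eq hx₂ hy ?_)
      simp only [sub_eq_add_neg, neg, Matrix.add_vecMulVec, Matrix.vecMulVec_add, add_assoc,
        add_left_comm, add_comm, tw']
    · refine Adj.symm (adj_of_sub_eq hx hy₂ ?_)
      simp only [sub_eq_add_neg, neg, Matrix.add_vecMulVec, Matrix.vecMulVec_add, add_assoc,
        add_left_comm, add_comm, tw']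
  have hB' : φ (x₁ ⊠ y₁ + (x₁ + x₂) ⊠ y₂) = 0 := by
    refine zero_of _ (adj_of_sub_eq hx hy₂ (add_sub_cancel_left _ _)) ?_
    refine R.corner hφ hx₁ hy₁ hx₂ hy (H _ _) hf hg' ?_ ?_
    · refine Adj.symm (adj_of_sub_eq hx₂ hy₂ ?_)
      simp only [sub_eq_add_neg, neg, Matrix.add_vecMulVec, Matrix.vecMulVec_add, add_assoc,
        add_left_comm, add_comm, tw']
    · refine Adj.symm (adj_of_sub_eq hx hy ?_)
      simp only [sub_eq_add_neg, neg, Matrix.add_vecMulVec, Matrix.vecMulVec_add, add_assoc,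
        add_left_comm, add_comm]
  refine (hφ _ _ (adj_of_sub_eq hx hy₁ ?_)).ne (hB.trans hB'.symm)
  simp only [sub_eq_add_neg, neg, Matrix.add_vecMulVec, Matrix.vecMulVec_add, add_assoc,
        add_left_comm, add_comm, tw, tw', add_zero]

end Propagation

section Propagation

variable {m n p q : Type*} {D K : Type*} [DivisionRing D] [DivisionRing K]

lemma RegularWith.shift_right {φ : Matrix m n D → Matrix p q K} {f : (m → D) → p → K}
    {g : (n → D) → q → K} (R : RegularWith φ f g) (h0 : φ 0 = 0) {x₁ : m → D} {y₁ : n → D}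
    (hx₁ : x₁ ≠ 0) (hy₁ : y₁ ≠ 0) :
    ∃ y y' : n → D, y ≠ 0 ∧ y' ≠ 0 ∧ ∃ w w', ¬ Par K w w' ∧ w ≠ 0 ∧
      shift φ (x₁ ⊠ y₁) (x₁ ⊠ y) = f x₁ ⊠ w ∧ shift φ (x₁ ⊠ y₁) (x₁ ⊠ y') = f x₁ ⊠ w' := by
  obtain ⟨y₂, hy₂, hg⟩ := R.exists_right y₁
  obtain ⟨c, hc, e⟩ := R.eq _ _ hx₁ hy₁
  obtain ⟨d, hd, e'⟩ := R.eq _ _ hx₁ hy₂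
  have hc' : -(c • g y₁) ≠ 0 := neg_ne_zero.2 (smul_ne_zero hc (R.right_ne _ hy₁))
  have hp : ¬ Par K (-(c • g y₁)) (d • g y₂ - c • g y₁) := by
    intro h
    apply hg
    have h := h.sub (Par.rfl' (R := K))
    rwa [sub_neg_eq_add, sub_add_cancel, par_smul_right_iff hd, ← neg_smul,
      par_smul_iff (neg_ne_zero.2 hc)] at h
  refine ⟨-y₁, y₂ - y₁, neg_ne_zero.2 hy₁, ?_, _, _, hp, hc', ?_, ?_⟩
  · rw [sub_ne_zero]
    rintro rfl
    exact hg Par.rfl'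
  · rw [shift, e, ← Matrix.vecMulVec_add, add_neg_cancel, tensor_zero, h0, Matrix.vecMulVec_neg,
      zero_sub]
  · rw [shift, e, ← Matrix.vecMulVec_add, add_sub_cancel, e', Matrix.vecMulVec_sub]

lemma RegularWith.shift_left {φ : Matrix m n D → Matrix p q K} {f : (m → D) → p → K}
    {g : (n → D) → q → K} (R : RegularWith φ f g) (h0 : φ 0 = 0) {x₁ : m → D} {y₁ : n → D}
    (hx₁ : x₁ ≠ 0) (hy₁ : y₁ ≠ 0) :
    ∃ x x' : m → D, ∃ w w', ¬ Par Kᵐᵒᵖ w w' ∧ w ≠ 0 ∧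
      shift φ (x₁ ⊠ y₁) (x ⊠ y₁) = w ⊠ g y₁ ∧ shift φ (x₁ ⊠ y₁) (x' ⊠ y₁) = w' ⊠ g y₁ := by
  obtain ⟨x₂, hx₂, hf⟩ := R.exists_left x₁
  obtain ⟨c, hc, e⟩ := R.eq _ _ hx₁ hy₁
  obtain ⟨d, hd, e'⟩ := R.eq _ _ hx₂ hy₁
  have hc0 : op c ≠ 0 := by simpa using hc
  have hd0 : op d ≠ 0 := by simpa using hd
  have hc' : -(op c • f x₁) ≠ 0 := neg_ne_zero.2 (smul_ne_zero hc0 (R.left_ne _ hx₁))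
  have hp : ¬ Par Kᵐᵒᵖ (-(op c • f x₁)) (op d • f x₂ - op c • f x₁) := by
    intro h
    apply hf
    have h := h.sub (Par.rfl' (R := Kᵐᵒᵖ))
    rwa [sub_neg_eq_add, sub_add_cancel, par_smul_right_iff hd0, ← neg_smul,
      par_smul_iff (neg_ne_zero.2 hc0)] at h
  refine ⟨-x₁, x₂ - x₁, _, _, hp, hc', ?_, ?_⟩
  · rw [shift, e, ← Matrix.add_vecMulVec, add_neg_cancel, zero_tensor, h0, Matrix.neg_vecMulVec,
      op_smul_tensor, zero_sub]
  · rw [shift, e, ← Matrix.add_vecMulVec, add_sub_cancel, e', Matrix.sub_vecMulVec,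
      op_smul_tensor, op_smul_tensor]

/-- Regularity propagates to adjacent points. -/
lemma RegularWith.shift {φ : Matrix m n D → Matrix p q K} {f : (m → D) → p → K}
    {g : (n → D) → q → K} (R : RegularWith φ f g) (hφ : Preserves φ) (h0 : φ 0 = 0)
    (hDK : (∀ d : D, d = 0 ∨ d = 1) → ∀ k : K, k = 0 ∨ k = 1) {x₁ : m → D} {y₁ : n → D}
    (hx₁ : x₁ ≠ 0) (hy₁ : y₁ ≠ 0) : Regular (shift φ (x₁ ⊠ y₁)) := by
  obtain ⟨i, -⟩ := Function.ne_iff.1 hx₁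
  obtain ⟨j, -⟩ := Function.ne_iff.1 hy₁
  have : Nonempty m := ⟨i⟩
  have : Nonempty n := ⟨j⟩
  have hf1 := R.left_ne _ hx₁
  have hg1 := R.right_ne _ hy₁
  obtain ⟨y, y', hy, hy', w, w', hw, hw0, e, e'⟩ := R.shift_right h0 hx₁ hy₁
  have hw0' : w' ≠ 0 := ne_zero_of_not_par_right hw
  rcases (hφ.shift (x₁ ⊠ y₁)).classify (shift_zero _ _) with C | C | ⟨f', g', C⟩
  · exfalso
    obtain ⟨x, x', z, z', hz, hz0, u, u'⟩ := R.shift_left h0 hx₁ hy₁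
    have hz0' : z' ≠ 0 := ne_zero_of_not_par_right hz
    obtain ⟨ξ, hξ, η, hη, C⟩ := C
    have hξ' : Par Kᵐᵒᵖ (f x₁) ξ := by
      have aux : ∀ y w, AdjacencyPreserver.shift φ (x₁ ⊠ y₁) (x₁ ⊠ y) = f x₁ ⊠ w → w ≠ 0 →
          Par Kᵐᵒᵖ (f x₁) ξ ∨ Par K η w := by
        intro y w e hw0
        rcases C x₁ y with ⟨v, hv⟩ | ⟨v, hv⟩
        · rw [e] at hv
          exact Or.inl ((par_of_tensor_eq hf1 hw0 hv).1.symm hf1)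
        · rw [e] at hv
          exact Or.inr (par_of_tensor_eq hf1 hw0 hv).2
      rcases aux _ _ e hw0 with h | h
      · exact h
      rcases aux _ _ e' hw0' with h' | h'
      · exact h'
      exact absurd ((h.symm hw0).trans h') hw
    have hη' : Par K (g y₁) η := by
      have aux : ∀ x w, AdjacencyPreserver.shift φ (x₁ ⊠ y₁) (x ⊠ y₁) = w ⊠ g y₁ → w ≠ 0 →
          Par K (g y₁) η ∨ Par Kᵐᵒᵖ ξ w := by
        intro y w e hw0
        rcases C y y₁ with ⟨v, hv⟩ | ⟨v, hv⟩
        · rw [e] at hv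
          exact Or.inr (par_of_tensor_eq hw0 hg1 hv).1
        · rw [e] at hv
          exact Or.inl ((par_of_tensor_eq hw0 hg1 hv).2.symm hg1)
      rcases aux _ _ u hz0 with h | h
      · exact h
      rcases aux _ _ u' hz0' with h' | h'
      · exact h'
      exact absurd ((h.symm hz0).trans h') hz
    have H : ∀ x y, (∃ v, φ (x₁ ⊠ y₁ + x ⊠ y) = f x₁ ⊠ v) ∨
        ∃ u, φ (x₁ ⊠ y₁ + x ⊠ y) = u ⊠ g y₁ := by
      intro x y
      obtain ⟨c, hc, ec⟩ := R.eq _ _ hx₁ hy₁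
      obtain ⟨a, rfl⟩ := hξ'
      obtain ⟨b, rfl⟩ := hη'
      rcases C x y with ⟨v, hv⟩ | ⟨v, hv⟩
      · rw [AdjacencyPreserver.shift, sub_eq_iff_eq_add, ec, smul_tensor,
          ← Matrix.vecMulVec_add] at hv
        exact Or.inl ⟨_, hv⟩
      · rw [AdjacencyPreserver.shift, sub_eq_iff_eq_add, ec, ← op_smul_tensor, ← op_smul_tensor,
          ← Matrix.add_vecMulVec] at hv
        exact Or.inr ⟨_, hv⟩
    by_cases hD : ∀ d : D, d = 0 ∨ d = 1
    · exact R.false_of_cross_of_two hφ hx₁ hy₁ H hD (hDK hD)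
    · push Not at hD
      obtain ⟨d, hd, hd'⟩ := hD
      exact R.false_of_cross hφ hx₁ hy₁ H (neg_ne_zero.2 hd) (by
        rw [← sub_eq_add_neg]
        exact sub_ne_zero.2 hd'.symm)
  · exact C
  · exfalso
    obtain ⟨c, hc, h⟩ := C.eq _ _ hx₁ hy
    obtain ⟨d, hd, h'⟩ := C.eq _ _ hx₁ hy'
    rw [e] at h
    rw [e'] at h'
    have h := (par_of_tensor_eq hf1 hw0 h).2
    have h' := (par_of_tensor_eq hf1 hw0' h').2
    rw [par_smul_iff hc] at h
    rw [par_smul_iff hd] at h'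
    exact hw ((h.symm hw0).trans h')

lemma single_eq_tensor [DecidableEq m] [DecidableEq n] (i : m) (j : n) (x : D) :
    Matrix.single i j x = Pi.single i x ⊠ Pi.single j 1 := by
  ext a b
  by_cases ha : i = a <;> by_cases hb : j = b <;>
    simp [Matrix.vecMulVec_apply, ha, hb, Matrix.single, eq_comm]

/-- A preserver that is regular at one point is regular everywhere. -/
lemma Regular.shift [Finite m] [Finite n] {φ : Matrix m n D → Matrix p q K} (R : Regular φ)
    (hφ : Preserves φ) (h0 : φ 0 = 0)
    (hDK : (∀ d : D, d = 0 ∨ d = 1) → ∀ k : K, k = 0 ∨ k = 1) (A : Matrix m n D) :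
    Regular (shift φ A) := by
  classical
  have shift0 : ∀ ψ : Matrix m n D → Matrix p q K, ψ 0 = 0 →
      AdjacencyPreserver.shift ψ 0 = ψ := fun ψ h => by
    funext M
    simp [AdjacencyPreserver.shift, h]
  induction A using Matrix.induction_on' generalizing φ with
  | h_zero => rwa [shift0 _ h0]
  | h_add A B hA hB =>
    rw [← shift_shift]
    exact hB (hA R hφ h0) (hφ.shift A) (shift_zero _ _)
  | h_std_basis i j x =>
    rw [single_eq_tensor]
    by_cases hx : x = 0
    · rw [hx, Pi.single_zero, zero_tensor]
      rwa [shift0 _ h0]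
    · obtain ⟨f, g, R⟩ := R
      exact R.shift hφ h0 hDK (by simpa using hx) (by simp)

end Propagation

section PlaneMap

variable {D K : Type*} [DivisionRing D] [DivisionRing K]

/-- An injective map of coordinate planes that maps lines into lines and fixes the origin and
the unit points of the axes. -/
structure PlaneMap (X Y : D → D → K) : Prop where
  line : ∀ s t p q, ∃ u v, ∀ r, ∃ k, X (s + r * p) (t + r * q) = X s t + k * u ∧
    Y (s + r * p) (t + r * q) = Y s t + k * v
  inj : ∀ s t s' t', X s t = X s' t' → Y s t = Y s' t' → s = s' ∧ t = t'
  x00 : X 0 0 = 0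
  y00 : Y 0 0 = 0
  x10 : X 1 0 = 1
  y10 : Y 1 0 = 0
  x01 : X 0 1 = 0
  y01 : Y 0 1 = 1

namespace PlaneMap

variable {X Y : D → D → K}

lemma swap (h : PlaneMap X Y) : PlaneMap (fun s t => Y t s) (fun s t => X t s) where
  line s t p q := by
    obtain ⟨u, v, H⟩ := h.line t s q p
    exact ⟨v, u, fun r => (H r).imp fun k hk => ⟨hk.2, hk.1⟩⟩
  inj s t s' t' h1 h2 := (h.inj t s t' s' h2 h1).symm
  x00 := h.y00
  y00 := h.x00
  x10 := h.y01
  y10 := h.x01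
  x01 := h.y10
  y01 := h.x10

lemma y_axis (h : PlaneMap X Y) (s : D) : Y s 0 = 0 := by
  obtain ⟨u, v, H⟩ := h.line 0 0 1 0
  obtain ⟨k, h1, h2⟩ := H 1
  obtain ⟨l, -, h4⟩ := H s
  simp only [mul_one, mul_zero, zero_add, h.x00, h.y00, h.x10, h.y10] at h1 h2 h4
  have hv : v = 0 := by
    rcases mul_eq_zero.1 h2.symm with hk | hv
    · simp [hk] at h1
    · exact hv
  rw [h4, hv, mul_zero]

lemma x_axis (h : PlaneMap X Y) (t : D) : X 0 t = 0 := h.swap.y_axis t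

lemma x_inj (h : PlaneMap X Y) {s s' : D} (e : X s 0 = X s' 0) : s = s' :=
  (h.inj s 0 s' 0 e (by rw [h.y_axis, h.y_axis])).1

lemma x_ne_zero (h : PlaneMap X Y) {s : D} (hs : s ≠ 0) : X s 0 ≠ 0 := fun e =>
  hs (h.x_inj (e.trans h.x00.symm))

lemma y_inj (h : PlaneMap X Y) {s s' : D} (e : Y 0 s = Y 0 s') : s = s' := h.swap.x_inj e

lemma y_ne_zero (h : PlaneMap X Y) {s : D} (hs : s ≠ 0) : Y 0 s ≠ 0 := h.swap.x_ne_zero hs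

lemma chord (h : PlaneMap X Y) {s t p q : D} (hs : s ≠ 0) (ht : t ≠ 0) (e : p * s + q * t = 1) :
    X p q * (X s⁻¹ 0)⁻¹ + Y p q * (Y 0 t⁻¹)⁻¹ = 1 := by
  obtain ⟨u, v, H⟩ := h.line s⁻¹ 0 (-s⁻¹) t⁻¹
  have hA := h.x_ne_zero (inv_ne_zero hs)
  have hB := h.y_ne_zero (inv_ne_zero ht)
  obtain ⟨k, h1, h2⟩ := H 1
  obtain ⟨l, h3, h4⟩ := H (q * t)
  have e' : s⁻¹ + q * t * -s⁻¹ = p := by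
    rw [mul_neg, ← sub_eq_add_neg, ← one_sub_mul, ← e, add_sub_cancel_right,
      mul_inv_cancel_right₀ hs]
  simp only [one_mul, add_neg_cancel, zero_add, h.x_axis, h.y_axis] at h1 h2
  rw [e', zero_add, mul_inv_cancel_right₀ ht] at h3 h4
  rw [h.y_axis, zero_add] at h4
  have hk : k ≠ 0 := by
    rintro rfl
    exact hB (by rw [h2, zero_mul])
  have hu : u = -(k⁻¹ * X s⁻¹ 0) := by
    rw [eq_neg_iff_add_eq_zero, ← mul_right_inj' hk, mul_add, mul_inv_cancel_left₀ hk, mul_zero,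
      h1, add_comm]
  have hv : v = k⁻¹ * Y 0 t⁻¹ := by rw [h2, inv_mul_cancel_left₀ hk]
  rw [h3, h4, hu, hv, mul_neg, add_mul, neg_mul, mul_inv_cancel₀ hA, ← mul_assoc, ← mul_assoc,
    mul_inv_cancel_right₀ hA, mul_inv_cancel_right₀ hB]
  abel

end PlaneMap

end PlaneMap

section PlaneMap

variable {D K : Type*} [DivisionRing D] [DivisionRing K]

/-- A functional equation forcing its solutions to come from a ring homomorphism. -/
lemma ringHom_of_chord [Infinite D] (hS : ∀ f : D →+* K, Function.Surjective f) (α β F : D → K)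
    (E : ∀ u s t s' t', u ≠ 0 → s ≠ 0 → t ≠ 0 → s' ≠ 0 → t' ≠ 0 → s + u * t ≠ 0 →
      s + u * t = s' + u * t' → α s + F u * β t = α s' + F u * β t')
    (hα : ∀ s s', s ≠ 0 → s' ≠ 0 → α s = α s' → s = s') (hα0 : ∀ s, s ≠ 0 → α s ≠ 0)
    (hβ0 : ∀ s, s ≠ 0 → β s ≠ 0) (hF : ∀ u, u ≠ 0 → F u ≠ 0) (hα1 : α 1 = 1) (hβ1 : β 1 = 1) :
    ∃ τ : D →+* K, ∀ s, s ≠ 0 → α s = τ s ∧ β s = τ s ∧ F s = τ s := by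
  classical
  have E' : ∀ u s s' t t', u ≠ 0 → s ≠ 0 → t ≠ 0 → s' ≠ 0 → t' ≠ 0 → s + u * t ≠ 0 →
      s - s' = u * (t' - t) → α s - α s' = F u * (β t' - β t) := by
    intro u s s' t t' hu hs ht hs' ht' h e
    have := E u s t s' t' hu hs ht hs' ht' h (by
      rw [sub_eq_iff_eq_add] at e
      rw [e, mul_sub]; abel)
    rw [mul_sub, sub_eq_sub_iff_add_eq_add, this]
    abel
  have hΔ : ∀ s s' r r', s ≠ 0 → s' ≠ 0 → r ≠ 0 → r' ≠ 0 → s - s' = r - r' →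
      α s - α s' = α r - α r' := by
    intro s s' r r' hs hs' hr hr' e
    obtain ⟨t, ht⟩ := Infinite.exists_notMem_finset ({0, s' - s, -s, -r} : Finset D)
    simp only [Finset.mem_insert, Finset.mem_singleton, not_or] at ht
    obtain ⟨h1, h2, h3, h4⟩ := ht
    have h5 : t + (s - s') ≠ 0 := fun h => h2 (by rw [eq_neg_of_add_eq_zero_left h, neg_sub])
    have h6 : s + 1 * t ≠ 0 := fun h => h3 (by
      rw [one_mul] at h; exact eq_neg_of_add_eq_zero_right h)
    have h7 : r + 1 * t ≠ 0 := fun h => h4 (by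
      rw [one_mul] at h; exact eq_neg_of_add_eq_zero_right h)
    rw [E' 1 s s' t (t + (s - s')) one_ne_zero hs h1 hs' h5 h6 (by simp),
      E' 1 r r' t (t + (s - s')) one_ne_zero hr h1 hr' h5 h7 (by simp [e])]
  have hex : ∀ δ : D, ∃ d : K, ∀ s s', s ≠ 0 → s' ≠ 0 → s - s' = δ → α s - α s' = d := by
    intro δ
    obtain ⟨t, ht⟩ := Infinite.exists_notMem_finset ({0, -δ} : Finset D)
    simp only [Finset.mem_insert, Finset.mem_singleton, not_or] at ht
    have h5 : t + δ ≠ 0 := fun h => ht.2 (eq_neg_of_add_eq_zero_left h)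
    exact ⟨α (t + δ) - α t, fun s s' hs hs' e =>
      hΔ _ _ _ _ hs hs' h5 ht.1 (e.trans (add_sub_cancel_left _ _).symm)⟩
  choose Δ hΔ using hex
  have hβΔ : ∀ u t t', u ≠ 0 → t ≠ 0 → t' ≠ 0 →
      Δ (u * (t' - t)) = F u * (β t' - β t) := by
    intro u t t' hu ht ht'
    obtain ⟨s, hs⟩ := Infinite.exists_notMem_finset
      ({0, u * (t' - t), -(u * t)} : Finset D)
    simp only [Finset.mem_insert, Finset.mem_singleton, not_or] at hs
    obtain ⟨h1, h2, h3⟩ := hs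
    have h4 : s - u * (t' - t) ≠ 0 := sub_ne_zero.2 h2
    have h5 : s + u * t ≠ 0 := fun h => h3 (eq_neg_of_add_eq_zero_left h)
    rw [← hΔ _ s _ h1 h4 (sub_sub_cancel _ _)]
    exact E' u _ _ _ _ hu h1 ht h4 ht' h5 (sub_sub_cancel _ _)
  have hmul : ∀ u δ, u ≠ 0 → Δ (u * δ) = F u * (F 1)⁻¹ * Δ δ := by
    intro u δ hu
    obtain ⟨t, ht⟩ := Infinite.exists_notMem_finset ({0, -δ} : Finset D)
    simp only [Finset.mem_insert, Finset.mem_singleton, not_or] at ht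
    have h5 : t + δ ≠ 0 := fun h => ht.2 (eq_neg_of_add_eq_zero_left h)
    have e1 := hβΔ u t (t + δ) hu ht.1 h5
    have e2 := hβΔ 1 t (t + δ) one_ne_zero ht.1 h5
    rw [add_sub_cancel_left] at e1 e2
    rw [one_mul] at e2
    rw [e1, e2, mul_assoc, inv_mul_cancel_left₀ (hF 1 one_ne_zero)]
  have hadd : ∀ δ ε, Δ (δ + ε) = Δ δ + Δ ε := by
    intro δ ε
    obtain ⟨t, ht⟩ := Infinite.exists_notMem_finset ({0, -ε, -(δ + ε)} : Finset D)
    simp only [Finset.mem_insert, Finset.mem_singleton, not_or] at ht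
    obtain ⟨h1, h2, h3⟩ := ht
    have h4 : t + ε ≠ 0 := fun h => h2 (eq_neg_of_add_eq_zero_left h)
    have h5 : t + (δ + ε) ≠ 0 := fun h => h3 (eq_neg_of_add_eq_zero_left h)
    rw [← hΔ _ _ _ h5 h1 (add_sub_cancel_left t (δ + ε)),
      ← hΔ _ _ _ h4 h1 (add_sub_cancel_left t ε), ← hΔ δ _ _ h5 h4 (by abel)]
    abel
  have hΔ0 : Δ 0 = 0 := by simpa using hadd 0 0
  have hΔne : ∀ δ, Δ δ = 0 → δ = 0 := by
    intro δ h
    obtain ⟨t, ht⟩ := Infinite.exists_notMem_finset ({0, -δ} : Finset D)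
    simp only [Finset.mem_insert, Finset.mem_singleton, not_or] at ht
    have h5 : t + δ ≠ 0 := fun h => ht.2 (eq_neg_of_add_eq_zero_left h)
    have e := hΔ _ _ _ h5 ht.1 (add_sub_cancel_left t δ)
    rw [h, sub_eq_zero] at e
    simpa using hα _ _ h5 ht.1 e
  have hΔ1 : Δ 1 ≠ 0 := fun h => one_ne_zero (hΔne 1 h)
  let τ : D →+* K :=
    { toFun := fun d => Δ d * (Δ 1)⁻¹
      map_one' := mul_inv_cancel₀ hΔ1
      map_mul' := fun u v => by
        by_cases hu : u = 0
        · simp [hu, hΔ0]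
        · have := hmul u 1 hu
          rw [mul_one] at this
          rw [this, hmul u v hu, mul_inv_cancel_right₀ hΔ1, mul_assoc]
      map_zero' := by rw [hΔ0, zero_mul]
      map_add' := fun u v => by rw [hadd, add_mul] }
  have hτ : ∀ d, Δ d = τ d * Δ 1 := fun d => (inv_mul_cancel_right₀ hΔ1 _).symm
  have aux : ∀ (γ : D → K) (c : K), c ≠ 0 → (∀ t t', t ≠ 0 → t' ≠ 0 → γ t' - γ t = c * Δ (t' - t)) →
      (∀ t, t ≠ 0 → γ t ≠ 0) → γ 1 = 1 → c * Δ 1 = 1 ∧ ∀ t, t ≠ 0 → γ t = c * Δ t := by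
    intro γ c hc hγ hγ0 hγ1
    have e : γ 1 - c * Δ 1 = 0 := by
      obtain ⟨s, hs⟩ := hS τ (-(c⁻¹ * (γ 1 - c * Δ 1)) * (Δ 1)⁻¹)
      have hs' : c * Δ s = -(γ 1 - c * Δ 1) := by
        rw [hτ, hs, inv_mul_cancel_right₀ hΔ1, mul_neg, mul_inv_cancel_left₀ hc]
      by_cases h0 : s = 0
      · rw [h0, hΔ0, mul_zero, eq_comm, neg_eq_zero] at hs'
        exact hs'
      · exfalso
        refine hγ0 s h0 ?_
        have h1 := hγ s 1 h0 one_ne_zero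
        have h2 := hadd s (1 - s)
        rw [add_sub_cancel] at h2
        rw [eq_sub_of_add_eq' h2.symm, mul_sub, hs'] at h1
        have h3 : c * Δ 1 - -(γ 1 - c * Δ 1) = γ 1 := by abel
        rw [h3] at h1
        exact sub_eq_self.1 h1
    have e1 : c * Δ 1 = 1 := by rw [← sub_eq_zero.1 e, hγ1]
    refine ⟨e1, fun t ht => ?_⟩
    have h1 := hγ 1 t one_ne_zero ht
    have h2 := hadd 1 (t - 1)
    rw [add_sub_cancel] at h2
    rw [eq_sub_of_add_eq' h2.symm, mul_sub, e1, hγ1] at h1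
    exact sub_left_inj.1 h1
  have hτ' : ∀ d, Δ d = τ d := by
    have := (aux α 1 one_ne_zero (fun t t' ht ht' => by
      rw [one_mul]; exact hΔ _ _ _ ht' ht rfl) hα0 hα1).1
    intro d
    rw [one_mul] at this
    rw [hτ, this, mul_one]
  have hα' := (aux α 1 one_ne_zero (fun t t' ht ht' => by
      rw [one_mul]; exact hΔ _ _ _ ht' ht rfl) hα0 hα1).2
  have hβ' := aux β (F 1)⁻¹ (inv_ne_zero (hF 1 one_ne_zero)) (fun t t' ht ht' => by
      have := hβΔ 1 t t' one_ne_zero ht ht'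
      rw [one_mul] at this
      rw [this, inv_mul_cancel_left₀ (hF 1 one_ne_zero)]) hβ0 hβ1
  have hF1 : (F 1)⁻¹ = 1 := by simpa [hτ'] using hβ'.1
  refine ⟨τ, fun s hs => ⟨?_, ?_, ?_⟩⟩
  · rw [hα' s hs, one_mul, hτ']
  · rw [hβ'.2 s hs, hF1, one_mul, hτ']
  · have := hmul s 1 hs
    rw [hF1, mul_one, mul_one, hτ', hτ', map_one, mul_one] at this
    exact this.symm

namespace PlaneMap

variable {X Y : D → D → K}

lemma x_ne_zero_of_infinite [Infinite D] (h : PlaneMap X Y) {p q : D} (hp : p ≠ 0) :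
    X p q ≠ 0 := by
  classical
  intro h0
  have key : ∀ t, t ≠ 0 → q * t ≠ 1 → Y p q * (Y 0 t⁻¹)⁻¹ = 1 := fun t ht hqt => by
    have := h.chord (s := p⁻¹ * (1 - q * t)) (t := t) (p := p) (q := q)
      (mul_ne_zero (inv_ne_zero hp) (sub_ne_zero.2 hqt.symm)) ht
      (by rw [mul_inv_cancel_left₀ hp, sub_add_cancel])
    rwa [h0, zero_mul, zero_add] at this
  have hq' : ∀ t, t ≠ q⁻¹ → q * t ≠ 1 := fun t ht e => ht (eq_inv_of_mul_eq_one_right e)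
  obtain ⟨a, ha⟩ := Infinite.exists_notMem_finset ({0, q⁻¹} : Finset D)
  obtain ⟨b, hb⟩ := Infinite.exists_notMem_finset ({0, q⁻¹, a} : Finset D)
  simp only [Finset.mem_insert, Finset.mem_singleton, not_or] at ha hb
  have ea := key a ha.1 (hq' a ha.2)
  have eb := key b hb.1 (hq' b hb.2.1)
  have hY : Y p q ≠ 0 := fun e => by simp [e] at ea
  exact hb.2.2 (inv_injective (h.y_inj (inv_injective (mul_left_cancel₀ hY (eb.trans ea.symm)))))

lemma ratio (h : PlaneMap X Y) {p u : D} (h1 : X 1 u ≠ 0) :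
    Y p (p * u) = X p (p * u) * ((X 1 u)⁻¹ * Y 1 u) := by
  obtain ⟨a, b, H⟩ := h.line 0 0 1 u
  obtain ⟨k, e1, e2⟩ := H 1
  obtain ⟨l, e3, e4⟩ := H p
  simp only [mul_one, one_mul, zero_add, h.x00, h.y00] at e1 e2 e3 e4
  have hk : k ≠ 0 := fun e => h1 (by rw [e1, e, zero_mul])
  have ha : a ≠ 0 := fun e => h1 (by rw [e1, e, mul_zero])
  rw [e1, e2, e3, e4, _root_.mul_inv_rev, mul_assoc, mul_assoc, inv_mul_cancel_left₀ hk,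
    mul_inv_cancel_left₀ ha]

lemma eq_ringHom_of_infinite [Infinite D] (hS : ∀ f : D →+* K, Function.Surjective f)
    (h : PlaneMap X Y) : ∃ τ : D →+* K, ∀ s t, X s t = τ s ∧ Y s t = τ t := by
  classical
  have hE : ∀ u s t, u ≠ 0 → s ≠ 0 → t ≠ 0 → s + u * t ≠ 0 →
      (X s⁻¹ 0)⁻¹ + (X 1 u)⁻¹ * Y 1 u * (Y 0 t⁻¹)⁻¹ =
        (X (s + u * t)⁻¹ ((s + u * t)⁻¹ * u))⁻¹ := by
    intro u s t hu hs ht hst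
    have := h.chord (p := (s + u * t)⁻¹) (q := (s + u * t)⁻¹ * u) hs ht
      (by rw [mul_assoc, ← mul_add, inv_mul_cancel₀ hst])
    rw [h.ratio (h.x_ne_zero_of_infinite one_ne_zero), mul_assoc (X _ _), ← mul_add] at this
    exact eq_inv_of_mul_eq_one_right this
  obtain ⟨τ, hτ⟩ := ringHom_of_chord hS (fun s => (X s⁻¹ 0)⁻¹) (fun t => (Y 0 t⁻¹)⁻¹)
    (fun u => (X 1 u)⁻¹ * Y 1 u)
    (fun u s t s' t' hu hs ht hs' ht' hst e => by
      rw [hE u s t hu hs ht hst, hE u s' t' hu hs' ht' (e ▸ hst), e])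
    (fun s s' _ _ e => inv_injective (h.x_inj (inv_injective e)))
    (fun s hs => inv_ne_zero (h.x_ne_zero (inv_ne_zero hs)))
    (fun s hs => inv_ne_zero (h.y_ne_zero (inv_ne_zero hs)))
    (fun u hu => mul_ne_zero (inv_ne_zero (h.x_ne_zero_of_infinite one_ne_zero))
      (h.swap.x_ne_zero_of_infinite hu))
    (by simp [h.x10]) (by simp [h.y01])
  have hX : ∀ s, X s 0 = τ s := fun s => by
    by_cases hs : s = 0
    · rw [hs, map_zero, h.x00]
    · have := (hτ s⁻¹ (inv_ne_zero hs)).1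
      rw [inv_inv, map_inv₀] at this
      exact inv_injective this
  have hY : ∀ s, Y 0 s = τ s := fun s => by
    by_cases hs : s = 0
    · rw [hs, map_zero, h.y00]
    · have := (hτ s⁻¹ (inv_ne_zero hs)).2.1
      rw [inv_inv, map_inv₀] at this
      exact inv_injective this
  refine ⟨τ, fun p q => ?_⟩
  by_cases hp : p = 0
  · rw [hp, h.x_axis, hY, map_zero]
    exact ⟨rfl, rfl⟩
  by_cases hq : q = 0
  · rw [hq, h.y_axis, hX, map_zero]
    exact ⟨rfl, rfl⟩
  have hu : p⁻¹ * q ≠ 0 := mul_ne_zero (inv_ne_zero hp) hq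
  have hF : (X 1 (p⁻¹ * q))⁻¹ * Y 1 (p⁻¹ * q) = τ (p⁻¹ * q) := (hτ _ hu).2.2
  have hXpq : X p q = τ p := by
    obtain ⟨s, hs⟩ := Infinite.exists_notMem_finset ({0, p⁻¹} : Finset D)
    simp only [Finset.mem_insert, Finset.mem_singleton, not_or] at hs
    obtain ⟨t, ht⟩ : ∃ t, s + p⁻¹ * q * t = p⁻¹ :=
      ⟨(p⁻¹ * q)⁻¹ * (p⁻¹ - s), by rw [mul_inv_cancel_left₀ hu, add_sub_cancel]⟩
    have ht0 : t ≠ 0 := by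
      rintro rfl
      simp only [mul_zero, add_zero] at ht
      exact hs.2 ht
    have := hE (p⁻¹ * q) s t hu hs.1 ht0 (by rw [ht]; exact inv_ne_zero hp)
    rw [ht, inv_inv, mul_inv_cancel_left₀ hp, hF, hX, hY, map_inv₀, map_inv₀, inv_inv, inv_inv,
      ← map_mul, ← map_add, ht, map_inv₀] at this
    exact (inv_injective this).symm
  refine ⟨hXpq, ?_⟩
  have := h.ratio (p := p) (u := p⁻¹ * q) (h.x_ne_zero_of_infinite one_ne_zero)
  rwa [mul_inv_cancel_left₀ hp, hXpq, hF, ← map_mul, mul_inv_cancel_left₀ hp] at this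

end PlaneMap

end PlaneMap

namespace PlaneMap

variable {D K : Type*} [DivisionRing D] [DivisionRing K] {X Y : D → D → K}

lemma x_eq_of_finite [Finite D] (hc : Nonempty (D ≃ K)) (h : PlaneMap X Y) (s t : D) :
    X s t = X s 0 := by
  obtain ⟨e⟩ := hc
  by_cases hs : s = 0
  · rw [hs, h.x_axis, h.x_axis]
  obtain ⟨u, v, H⟩ := h.line s 0 0 1
  simp only [mul_zero, mul_one, add_zero, zero_add] at H
  choose k hX hY using H
  have hk : Function.Injective k := fun r r' hr =>
    (h.inj s r s r' (by rw [hX r, hX r', hr]) (by rw [hY r, hY r', hr])).2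
  have hu : u = 0 := by
    by_contra hu
    obtain ⟨r, hr⟩ := (hk.surjective_of_finite e) (-(X s 0) * u⁻¹)
    obtain ⟨t', ht'⟩ := (Function.Injective.surjective_of_finite e
      (fun a b hab => h.y_inj hab : Function.Injective fun b => Y 0 b)) (Y s r)
    refine hs (h.inj s r 0 t' ?_ ht'.symm).1
    rw [h.x_axis, hX, hr, inv_mul_cancel_right₀ hu, add_neg_cancel]
  rw [hX, hu, mul_zero, add_zero]

lemma y_eq_of_finite [Finite D] (hc : Nonempty (D ≃ K)) (h : PlaneMap X Y) (s t : D) :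
    Y s t = Y 0 t := h.swap.x_eq_of_finite hc t s

lemma eq_ringHom_of_finite [Finite D] (hc : Nonempty (D ≃ K)) (h3 : ∃ r : D, r ≠ 0 ∧ r ≠ 1)
    (h : PlaneMap X Y) : ∃ τ : D →+* K, ∀ s t, X s t = τ s ∧ Y s t = τ t := by
  have hmul : ∀ r q, Y 0 (r * q) = X r 0 * Y 0 q := by
    intro r q
    obtain ⟨u, v, H⟩ := h.line 0 0 1 q
    obtain ⟨k, e1, e2⟩ := H 1
    obtain ⟨l, e3, e4⟩ := H r
    simp only [mul_one, one_mul, zero_add, h.x00, h.y00, h.x_eq_of_finite hc 1 q,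
      h.y_eq_of_finite hc 1 q, h.x_eq_of_finite hc r (r * q), h.x10,
      h.y_eq_of_finite hc r (r * q)] at e1 e2 e3 e4
    have hk : k ≠ 0 := fun e => by simp [e] at e1
    rw [e4, e2, e3, eq_inv_of_mul_eq_one_right e1.symm, mul_assoc, inv_mul_cancel_left₀ hk]
  have hXY : ∀ r, Y 0 r = X r 0 := fun r => by
    have := hmul r 1
    rwa [mul_one, h.y01, mul_one] at this
  have hsub : ∀ c r, c ≠ 0 → X (c - r) 0 = X c 0 - X r 0 := by
    intro c r hc0
    obtain ⟨u, v, H⟩ := h.line c 0 (-1) 1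
    obtain ⟨k, e1, e2⟩ := H c
    obtain ⟨l, e3, e4⟩ := H r
    simp only [mul_one, mul_neg, zero_add, add_neg_cancel, h.x_axis, h.y_axis, hXY] at e1 e2
    rw [h.x_eq_of_finite hc, mul_neg, mul_one, ← sub_eq_add_neg] at e3
    rw [h.y_eq_of_finite hc, mul_one, zero_add, h.y_axis, zero_add, hXY] at e4
    have hk : k ≠ 0 := fun e => h.x_ne_zero hc0 (by rw [e2, e, zero_mul])
    have huv : u = -v := by
      rw [eq_neg_iff_add_eq_zero, ← mul_right_inj' hk, mul_add, mul_zero, ← e2, add_comm, ← e1]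
    rw [e3, e4, huv, mul_neg, sub_eq_add_neg]
  have hneg : ∀ r, X (-r) 0 = -X r 0 := by
    intro r
    by_cases hr : r = 0
    · rw [hr, neg_zero, h.x00, neg_zero]
    obtain ⟨s, hs0, hs1⟩ := h3
    have hd : -r * s ≠ 0 := mul_ne_zero (neg_ne_zero.2 hr) hs0
    have hd' : -r * s + r ≠ 0 := fun e => hs1 (mul_left_cancel₀ (neg_ne_zero.2 hr)
      (by rw [eq_neg_of_add_eq_zero_left e, mul_one]))
    have h1 := hsub (-r * s) (-r * s + r) hd
    have h2 := hsub (-r * s + r) r hd'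
    rw [add_sub_cancel_right] at h2
    rw [sub_add_cancel_left, h2] at h1
    rw [h1]; abel
  let τ : D →+* K :=
    { toFun := fun s => X s 0
      map_one' := h.x10
      map_mul' := fun a b => by rw [← hXY, hmul, hXY]
      map_zero' := h.x00
      map_add' := fun a b => by
        by_cases ha : a = 0
        · rw [ha, zero_add, h.x00, zero_add]
        · rw [← sub_neg_eq_add, hsub _ _ ha, hneg, sub_neg_eq_add] }
  exact ⟨τ, fun s t => ⟨h.x_eq_of_finite hc s t, (h.y_eq_of_finite hc s t).trans (hXY t)⟩⟩

lemma eq_ringHom (hS : ∀ f : D →+* K, Function.Surjective f) (hc : Nonempty (D ≃ K))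
    (h3 : ∃ r : D, r ≠ 0 ∧ r ≠ 1) (h : PlaneMap X Y) :
    ∃ τ : D →+* K, ∀ s t, X s t = τ s ∧ Y s t = τ t := by
  rcases finite_or_infinite D with _ | _
  · exact h.eq_ringHom_of_finite hc h3
  · exact h.eq_ringHom_of_infinite hS

end PlaneMap

section Lineation

variable {D K V W : Type*} [DivisionRing D] [DivisionRing K] [AddCommGroup V] [Module D V]
  [AddCommGroup W] [Module K W]

variable (D K) in
/-- An injective map between vector spaces that maps lines into lines and fixes the origin. -/
structure Lineation (a : V → W) : Prop where
  zero : a 0 = 0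
  inj : Function.Injective a
  line : ∀ (v y : V) (s : D), Par K (a (v + y) - a v) (a (v + s • y) - a v)

namespace Lineation

variable {a : V → W}

lemma ne_zero (h : Lineation D K a) {y : V} (hy : y ≠ 0) : a y ≠ 0 := fun e =>
  hy (h.inj (e.trans h.zero.symm))

lemma par_smul (h : Lineation D K a) (y : V) (s : D) : Par K (a y) (a (s • y)) := by
  simpa [h.zero] using h.line 0 y s

lemma not_par (h : Lineation D K a) {y z : V} (hyz : ¬ Par K (a y) (a z)) : ¬ Par D y z := by
  rintro ⟨c, rfl⟩
  exact hyz (h.par_smul y c)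

lemma exists_coordinates (h : Lineation D K a) (h3 : ∃ r : D, r ≠ 0 ∧ r ≠ 1) {y z : V}
    (p q : D) : ∃ u v : K, a (p • y + q • z) = u • a y + v • a z := by
  by_cases hp : p = 0
  · obtain ⟨k, hk⟩ := h.par_smul z q
    exact ⟨0, k, by rw [hp, zero_smul, zero_add, zero_smul, zero_add, hk]⟩
  by_cases hq : q = 0
  · obtain ⟨k, hk⟩ := h.par_smul y p
    exact ⟨k, 0, by rw [hq, zero_smul, add_zero, zero_smul, add_zero, hk]⟩
  obtain ⟨d, hd0, hd1⟩ := h3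
  obtain ⟨k, hk⟩ := h.line (d⁻¹ • p • y) ((1 - d)⁻¹ • q • z - d⁻¹ • p • y) (1 - d)
  have e : d⁻¹ • p • y + (1 - d) • ((1 - d)⁻¹ • q • z - d⁻¹ • p • y) = p • y + q • z := by
    rw [smul_sub, smul_inv_smul₀ (sub_ne_zero.2 hd1.symm), sub_smul, one_smul,
      smul_inv_smul₀ hd0]
    abel
  rw [e, add_sub_cancel, smul_smul, smul_smul] at hk
  obtain ⟨k₁, hk₁⟩ := h.par_smul y (d⁻¹ * p)
  obtain ⟨k₂, hk₂⟩ := h.par_smul z ((1 - d)⁻¹ * q)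
  refine ⟨k₁ - k * k₁, k * k₂, ?_⟩
  rw [← hk₁, ← hk₂, eq_sub_iff_add_eq] at hk
  rw [← hk, smul_sub, sub_smul, mul_smul, mul_smul]
  abel

lemma exists_ringHom_plane (h : Lineation D K a) (hS : ∀ f : D →+* K, Function.Surjective f)
    (hc : Nonempty (D ≃ K)) (h3 : ∃ r : D, r ≠ 0 ∧ r ≠ 1) {y z : V} (hy : y ≠ 0)
    (hyz : ¬ Par K (a y) (a z)) :
    ∃ τ : D →+* K, ∀ s t : D, a (s • y + t • z) = τ s • a y + τ t • a z := by
  have hay := h.ne_zero hy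
  choose X Y hXY using fun p q => h.exists_coordinates h3 (y := y) (z := z) p q
  have huniq : ∀ u v u' v' : K, u • a y + v • a z = u' • a y + v' • a z → u = u' ∧ v = v' := by
    intro u v u' v' e
    have := eq_zero_of_not_par hay hyz (a := u - u') (b := v - v') (by
      rw [sub_smul, sub_smul, sub_add_sub_comm, e, sub_self])
    exact ⟨sub_eq_zero.1 this.1, sub_eq_zero.1 this.2⟩
  have hval : ∀ p q u v, a (p • y + q • z) = u • a y + v • a z → X p q = u ∧ Y p q = v :=
    fun p q u v e => huniq _ _ _ _ ((hXY p q).symm.trans e)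
  have h00 := hval 0 0 0 0 (by simp [h.zero])
  have h10 := hval 1 0 1 0 (by simp)
  have h01 := hval 0 1 0 1 (by simp)
  have hP : PlaneMap X Y :=
    { line := fun s t p q => by
        refine ⟨X (s + p) (t + q) - X s t, Y (s + p) (t + q) - Y s t, fun r => ?_⟩
        obtain ⟨k, hk⟩ := h.line (s • y + t • z) (p • y + q • z) r
        have e1 : s • y + t • z + (p • y + q • z) = (s + p) • y + (t + q) • z := by
          rw [add_smul, add_smul]; abel
        have e2 : s • y + t • z + r • (p • y + q • z) = (s + r * p) • y + (t + r * q) • z := by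
          rw [add_smul, add_smul, mul_smul, mul_smul, smul_add]; abel
        rw [e1, e2, hXY (s + p), hXY s t, eq_sub_iff_add_eq] at hk
        refine ⟨k, hval _ _ _ _ ?_⟩
        rw [← hk, smul_sub, smul_add, smul_add, add_smul, add_smul, mul_sub, mul_sub, sub_smul,
          sub_smul]
        simp only [mul_smul]
        abel
      inj := fun s t s' t' e1 e2 => by
        have e : s • y + t • z = s' • y + t' • z := h.inj (by rw [hXY, hXY, e1, e2])
        have := eq_zero_of_not_par hy (h.not_par hyz) (a := s - s') (b := t - t') (by
          rw [sub_smul, sub_smul, sub_add_sub_comm, e, sub_self])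
        exact ⟨sub_eq_zero.1 this.1, sub_eq_zero.1 this.2⟩
      x00 := h00.1
      y00 := h00.2
      x10 := h10.1
      y10 := h10.2
      x01 := h01.1
      y01 := h01.2 }
  obtain ⟨τ, hτ⟩ := hP.eq_ringHom hS hc h3
  exact ⟨τ, fun s t => by rw [hXY, (hτ s t).1, (hτ s t).2]⟩

/-- A form of the fundamental theorem of affine geometry. -/
theorem exists_ringHom (h : Lineation D K a) (hS : ∀ f : D →+* K, Function.Surjective f)
    (hc : Nonempty (D ≃ K)) (h3 : ∃ r : D, r ≠ 0 ∧ r ≠ 1) {y z : V} (hy : y ≠ 0)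
    (hyz : ¬ Par K (a y) (a z)) :
    ∃ τ : D →+* K, (∀ (s : D) v, a (s • v) = τ s • a v) ∧ ∀ v w, a (v + w) = a v + a w := by
  have hz : ∀ {x : V}, x ≠ 0 → a x ≠ 0 := h.ne_zero
  obtain ⟨τ, hτ⟩ := h.exists_ringHom_plane hS hc h3 hy hyz
  have htrans : ∀ {x v : V}, x ≠ 0 → (∀ s : D, a (s • x) = τ s • a x) → ¬ Par K (a x) (a v) →
      ∀ s t : D, a (s • x + t • v) = τ s • a x + τ t • a v := by
    intro x v hx hxτ hxv
    obtain ⟨τ', hτ'⟩ := h.exists_ringHom_plane hS hc h3 hx hxv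
    have : τ' = τ := by
      ext s
      have e := hτ' s 0
      rw [zero_smul, add_zero, map_zero, zero_smul, add_zero, hxτ] at e
      exact (smul_left_injective K (hz hx) e).symm
    exact this ▸ hτ'
  have hyτ : ∀ s : D, a (s • y) = τ s • a y := fun s => by simpa using hτ s 0
  have hzτ : ∀ s : D, a (s • z) = τ s • a z := fun s => by simpa using hτ 0 s
  have hz0 : z ≠ 0 := by
    rintro rfl
    exact hyz (h.zero ▸ Par.zero_right _)
  have hsmul : ∀ (s : D) v, a (s • v) = τ s • a v := by
    intro s v
    by_cases hv : v = 0
    · rw [hv, smul_zero, h.zero, smul_zero]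
    by_cases hyv : Par K (a y) (a v)
    · have hzv : ¬ Par K (a z) (a v) := fun hzv =>
        hyz (hyv.trans (hzv.symm (hz hv)))
      simpa using htrans hz0 hzτ hzv 0 s
    · simpa using htrans hy hyτ hyv 0 s
  refine ⟨τ, hsmul, fun v w => ?_⟩
  by_cases hv : v = 0
  · rw [hv, zero_add, h.zero, zero_add]
  by_cases hvw : Par K (a v) (a w)
  · obtain ⟨c, hvw⟩ := hvw
    obtain ⟨d, rfl⟩ := hS τ c
    rw [← hsmul] at hvw
    rw [← h.inj hvw]
    have := hsmul (1 + d) v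
    rwa [add_smul, one_smul, map_add, map_one, add_smul, one_smul, ← hsmul d] at this
  · simpa using htrans hv (fun s => hsmul s v) hvw 1 1

end Lineation

end Lineation

section Slices

variable {m n p q : Type*} {D K : Type*} [DivisionRing D] [DivisionRing K]

lemma map_tensor {V : Type*} [AddCommGroup V] [Module K V] (T : (q → K) →ₗ[K] V) (x : p → K)
    (v : q → K) (i : p) : T ((x ⊠ v) i) = x i • T v := by
  rw [← map_smul]
  rfl

lemma mem_span_pair_of_tensor {z₁ z₂ z z' : p → K} {w₁ w₂ w w' : q → K} (hz₁ : z₁ ≠ 0)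
    (hw₁ : w₁ ≠ 0) (hz : ¬ Par Kᵐᵒᵖ z₁ z₂) (hw : ¬ Par K w₁ w₂)
    (h : z₁ ⊠ w₁ + z₂ ⊠ w₂ - z ⊠ w = z' ⊠ w') : w ∈ Submodule.span K {w₁, w₂} := by
  by_contra hmem
  obtain ⟨l, hl, hker⟩ := Submodule.exists_le_ker_of_notMem hmem
  let T : (q → K) →ₗ[K] (q → K) :=
    LinearMap.id - (LinearMap.toSpanSingleton K (q → K) ((l w)⁻¹ • w)).comp l
  have hT : ∀ v, T v = v - l v • (l w)⁻¹ • w := fun v => rfl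
  have h1 : T w₁ = w₁ := by
    rw [hT, LinearMap.mem_ker.1 (hker (Submodule.subset_span (by simp))), zero_smul, sub_zero]
  have h2 : T w₂ = w₂ := by
    rw [hT, LinearMap.mem_ker.1 (hker (Submodule.subset_span (by simp))), zero_smul, sub_zero]
  have h3 : T w = 0 := by rw [hT, smul_inv_smul₀ hl, sub_self]
  have e : z₁ ⊠ w₁ - (-z₂) ⊠ w₂ = z' ⊠ T w' := by
    rw [Matrix.neg_vecMulVec, sub_neg_eq_add]
    funext i
    have := congrArg T (congrFun h i)
    change T (((z₁ ⊠ w₁) i + (z₂ ⊠ w₂) i) - (z ⊠ w) i) = _ at this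
    rw [map_sub, map_add, map_tensor, map_tensor, map_tensor, map_tensor, h1, h2, h3, smul_zero,
      sub_zero] at this
    exact this
  rcases par_or_par hz₁ hw₁ e with h' | h'
  · obtain ⟨c, hc⟩ := h'
    exact hz ⟨-c, by rw [neg_smul, hc, neg_neg]⟩
  · exact hw h'

/-- An adjacency preserver fixing zero that is regular at every point. -/
structure RegularPreserver (φ : Matrix m n D → Matrix p q K) : Prop where
  preserves : Preserves φ
  zero : φ 0 = 0
  regular : ∀ A, Regular (shift φ A)

lemma add_self_of_two {M : Type*} [AddCommGroup M] [Module D M] (h2 : ∀ d : D, d = 0 ∨ d = 1)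
    (x : M) : x + x = 0 := add_eq_zero_iff_eq_neg.2 (neg_eq_of_two h2 x).symm

lemma two_of_equiv (hc : Nonempty (D ≃ K)) (hD : ∀ d : D, d = 0 ∨ d = 1) (k : K) :
    k = 0 ∨ k = 1 := by
  obtain ⟨e⟩ := hc
  have h := fun a b (hab : a ≠ b) => e.symm.injective.ne hab
  by_contra! hk
  have h1 := h 0 1 zero_ne_one
  have h2 := h k 0 hk.1
  have h3 := h k 1 hk.2
  rcases hD (e.symm 0) with e0 | e0 <;> rcases hD (e.symm 1) with e1 | e1 <;>
    rcases hD (e.symm k) with e2 | e2 <;> simp_all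

lemma exists_ringHom_of_two (hD : ∀ d : D, d = 0 ∨ d = 1) (hK : ∀ k : K, k = 0 ∨ k = 1) :
    Nonempty (D →+* K) := by
  classical
  have hD2 : (1 : D) + 1 = 0 := add_self_of_two hD 1
  have hK2 : (1 : K) + 1 = 0 := add_self_of_two hK 1
  exact ⟨{
    toFun := fun d => if d = 0 then 0 else 1
    map_one' := by simp
    map_mul' := fun a b => by rcases hD a with rfl | rfl <;> rcases hD b with rfl | rfl <;> simp
    map_zero' := by simp
    map_add' := fun a b => by
      rcases hD a with rfl | rfl <;> rcases hD b with rfl | rfl <;> simp [hD2, hK2] }⟩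

namespace RegularPreserver

variable {φ : Matrix m n D → Matrix p q K} {f : (m → D) → p → K} {g : (n → D) → q → K}

lemma shift (h : RegularPreserver φ) (A : Matrix m n D) : RegularPreserver (shift φ A) where
  preserves := h.preserves.shift A
  zero := shift_zero φ A
  regular B := by
    rw [shift_shift]
    exact h.regular _

lemma exists_lineation (h : RegularPreserver φ) (R : RegularWith φ f g) {x : m → D}
    (hx : x ≠ 0) : ∃ a : (n → D) → q → K, (∀ v, φ (x ⊠ v) = f x ⊠ a v) ∧
      (∀ v, v ≠ 0 → ∃ c : K, c ≠ 0 ∧ a v = c • g v) ∧ Lineation D K a := by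
  classical
  have : Nonempty m := ⟨(Function.ne_iff.1 hx).choose⟩
  choose c hc0 hc using fun v hv => R.eq x v hx hv
  let a : (n → D) → q → K := fun v => if hv : v = 0 then 0 else c v hv • g v
  have ha : ∀ v, φ (x ⊠ v) = f x ⊠ a v := by
    intro v
    by_cases hv : v = 0
    · simp [a, hv, h.zero]
    · simp only [a, dif_neg hv, hc v hv]
  have hinj : Function.Injective a := by
    intro v v' e
    by_contra hne
    exact (h.preserves _ _ (adj_tensor_right hx hne)).ne (by rw [ha, ha, e])
  have ha0 : a 0 = 0 := by simp [a]
  refine ⟨a, ha, fun v hv => ⟨c v hv, hc0 v hv, by simp only [a, dif_neg hv]⟩, ha0, hinj, ?_⟩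
  intro v y s
  by_cases hy : y = 0
  · simp [hy, Par.zero_right]
  by_cases hs : s = 0
  · simp [hs, Par.zero_right]
  obtain ⟨f', g', R'⟩ := h.regular (x ⊠ v)
  have key : ∀ y, y ≠ 0 → a (v + y) - a v ≠ 0 ∧ Par K (g' y) (a (v + y) - a v) := by
    intro y hy
    have hne : a (v + y) - a v ≠ 0 := by
      rw [sub_ne_zero]
      exact fun e => hy (by simpa using hinj e)
    obtain ⟨k, hk, e⟩ := R'.eq x y hx hy
    rw [AdjacencyPreserver.shift, ← Matrix.vecMulVec_add, ha, ha, ← Matrix.vecMulVec_sub] at e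
    exact ⟨hne, (par_smul_iff hk).1 (par_of_tensor_eq (R.left_ne x hx) hne e).2⟩
  have h1 := key y hy
  exact (h1.2.symm h1.1).trans ((R'.par_right hy hs).trans (key _ (smul_ne_zero hs hy)).2)

lemma add_of_two (h : RegularPreserver φ) (R : RegularWith φ f g)
    (hD : ∀ d : D, d = 0 ∨ d = 1) (hK : ∀ k : K, k = 0 ∨ k = 1) {x : m → D} (hx : x ≠ 0)
    {a : (n → D) → q → K} (ha : ∀ v, φ (x ⊠ v) = f x ⊠ a v)
    (hag : ∀ v, v ≠ 0 → ∃ c : K, c ≠ 0 ∧ a v = c • g v) (hl : Lineation D K a)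
    (v w : n → D) : a (v + w) = a v + a w := by
  by_cases hv : v = 0
  · rw [hv, zero_add, hl.zero, zero_add]
  by_cases hw : w = 0
  · rw [hw, add_zero, hl.zero, add_zero]
  by_cases hvw : v = w
  · rw [hvw, add_self_of_two hD, add_self_of_two hK, hl.zero]
  have hK1 : ∀ k : K, k ≠ 0 → k = 1 := fun k hk => (hK k).resolve_left hk
  have hagv : ∀ v, v ≠ 0 → a v = g v := fun v hv => by
    obtain ⟨c, hc, e⟩ := hag v hv
    rw [e, hK1 c hc, one_smul]
  have hpar : ∀ {V : Type _} [AddCommGroup V] [Module K V] {u u' : V}, u' ≠ 0 → Par K u u' →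
      u = u' := by
    rintro V _ _ u u' hu' ⟨c, rfl⟩
    rw [hK1 c (fun e => hu' (by rw [e, zero_smul])), one_smul]
  have hpar' : ∀ {V : Type _} [AddCommGroup V] [Module Kᵐᵒᵖ V] {u u' : V}, u' ≠ 0 →
      Par Kᵐᵒᵖ u u' → u = u' := by
    rintro V _ _ u u' hu' ⟨c, rfl⟩
    rw [← op_unop c, hK1 (unop c) (fun e => hu' (by
      rw [(unop_eq_zero_iff c).1 e, zero_smul])), op_one, one_smul]
  obtain ⟨x', hx', hxx'⟩ := R.exists_left x
  obtain ⟨f', g', R'⟩ := h.regular (x ⊠ v)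
  have eqR' : ∀ x y, x ≠ 0 → y ≠ 0 →
      AdjacencyPreserver.shift φ (_) (x ⊠ y) = f' x ⊠ g' y := fun x y hx hy => by
    obtain ⟨c, hc, e⟩ := R'.eq x y hx hy
    rw [e, hK1 c hc, one_smul]
  have hne : a (v + w) - a v ≠ 0 := by
    rw [sub_ne_zero]
    exact fun e => hw (by simpa using hl.inj e)
  have e1 := eqR' x w hx hw
  rw [AdjacencyPreserver.shift, ← Matrix.vecMulVec_add, ha, ha, ← Matrix.vecMulVec_sub] at e1
  obtain ⟨p1, p2⟩ := par_of_tensor_eq (R.left_ne x hx) hne e1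
  have hf' : f' x = f x := hpar' (R.left_ne x hx) p1
  have hg' : g' w = a (v + w) - a v := hpar hne p2
  have hf'x' : ¬ Par Kᵐᵒᵖ (f x) (f' x') := by
    intro hp
    have := hpar' (R'.left_ne x' hx') hp
    have hxx : x ≠ x' := fun e => hxx' (e ▸ Par.rfl')
    have hadj := (h.preserves.shift (x ⊠ v)) _ _ (adj_tensor_left hxx hw)
    rw [eqR' x w hx hw, eqR' x' w hx' hw, hf', this] at hadj
    exact hadj.ne rfl
  have hvw0 : v + w ≠ 0 := by
    intro e
    exact hvw (by rw [eq_neg_of_add_eq_zero_left e, neg_eq_of_two hD])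
  have hww : ¬ Par K (a v) (a (v + w) - a v) := by
    intro hp
    have := hpar hne hp
    rw [eq_sub_iff_add_eq] at this
    rw [← this] at hne
    refine hl.ne_zero hvw0 ?_
    rw [← this, add_self_of_two hK]
  have e2 := eqR' x' w hx' hw
  rw [AdjacencyPreserver.shift, ha, hg', sub_eq_iff_eq_add] at e2
  obtain ⟨z', w', hz', hw', e3⟩ := h.preserves (x ⊠ v + x' ⊠ w) (x' ⊠ w)
    ⟨x, v, hx, hv, by rw [add_sub_cancel_right]⟩
  obtain ⟨c, hc, e4⟩ := R.eq x' w hx' hw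
  rw [e2, e4, hK1 c hc, one_smul, ← hagv w hw, add_comm (f' x' ⊠ _)] at e3
  have hmem := mem_span_pair_of_tensor (R.left_ne x hx) (hl.ne_zero hv) hf'x' hww e3
  obtain ⟨s, t, hst⟩ := Submodule.mem_span_pair.1 hmem
  rcases hK s with rfl | rfl <;> rcases hK t with rfl | rfl
  · simp only [zero_smul, add_zero] at hst
    exact absurd hst.symm (hl.ne_zero hw)
  · simp only [zero_smul, one_smul, zero_add] at hst
    rw [← hst, add_sub_cancel]
  · simp only [zero_smul, one_smul, add_zero] at hst
    exact absurd (hl.inj hst) hvw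
  · simp only [one_smul, add_sub_cancel] at hst
    exact absurd (by simpa using hl.inj hst) hv

/-- On a row space of the domain, the map is semilinear. -/
lemma exists_semilinear_slice (h : RegularPreserver φ) (R : RegularWith φ f g)
    (hS : ∀ f : D →+* K, Function.Surjective f) (hc : Nonempty (D ≃ K))
    {x : m → D} (hx : x ≠ 0) : ∃ a : (n → D) → q → K, (∀ v, φ (x ⊠ v) = f x ⊠ a v) ∧
      (∀ v, v ≠ 0 → ∃ c : K, c ≠ 0 ∧ a v = c • g v) ∧ Function.Injective a ∧
      (∀ v w, a (v + w) = a v + a w) ∧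
      ∃ τ : D →+* K, ∀ (s : D) v, a (s • v) = τ s • a v := by
  obtain ⟨a, ha, hag, hl⟩ := h.exists_lineation R hx
  obtain ⟨y, z, hy, hz, hyz⟩ := R.right_ex
  refine ⟨a, ha, hag, hl.inj, ?_⟩
  by_cases h3 : ∃ r : D, r ≠ 0 ∧ r ≠ 1
  · obtain ⟨τ, h1, h2⟩ := hl.exists_ringHom hS hc h3 hy (z := z) (by
      obtain ⟨c, hc0, e⟩ := hag y hy
      obtain ⟨d, hd0, e'⟩ := hag z hz
      rwa [e, e', par_smul_iff hc0, par_smul_right_iff hd0])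
    exact ⟨h2, τ, h1⟩
  · have hD : ∀ d : D, d = 0 ∨ d = 1 := by
      intro d
      by_contra! hd
      exact h3 ⟨d, hd⟩
    have hK := two_of_equiv hc hD
    have hadd := h.add_of_two R hD hK hx ha hag hl
    obtain ⟨τ⟩ := exists_ringHom_of_two hD hK
    refine ⟨hadd, τ, fun s v => ?_⟩
    rcases hD s with rfl | rfl <;> simp [hl.zero]

end RegularPreserver

end Slices

section OpTranspose

variable {m n p q : Type*} {D K : Type*} [DivisionRing D] [DivisionRing K]

/-- A vector viewed over the opposite division ring. -/
def opVec : (m → K) ≃+ (m → Kᵐᵒᵖ) where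
  toFun x i := op (x i)
  invFun x i := unop (x i)
  left_inv _ := rfl
  right_inv _ := rfl
  map_add' _ _ := rfl

/-- Transposition, as a map to matrices over the opposite division ring. -/
def opTr : Matrix m n K ≃+ Matrix n m Kᵐᵒᵖ where
  toFun M := Matrix.of fun j i => op (M i j)
  invFun M := Matrix.of fun i j => unop (M j i)
  left_inv _ := rfl
  right_inv _ := rfl
  map_add' _ _ := rfl

lemma opTr_tensor (x : m → K) (v : n → K) : opTr (x ⊠ v) = opVec v ⊠ opVec x := rfl

lemma opTr_symm_tensor (x : m → Kᵐᵒᵖ) (v : n → Kᵐᵒᵖ) :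
    opTr.symm (x ⊠ v) = opVec.symm v ⊠ opVec.symm x := rfl

lemma opVec_ne_zero {x : m → K} : opVec x ≠ 0 ↔ x ≠ 0 := by simp

lemma opVec_symm_ne_zero {x : m → Kᵐᵒᵖ} : opVec.symm x ≠ 0 ↔ x ≠ 0 := by simp

lemma opVec_op_smul (c : Kᵐᵒᵖ) (x : m → K) : opVec (c • x) = c • opVec x := rfl

lemma opVec_smul (c : K) (x : m → K) : opVec (c • x) = op (op c) • opVec x := rfl

lemma opVec_symm_smul (c : Kᵐᵒᵖ) (x : m → Kᵐᵒᵖ) :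
    opVec.symm (c • x) = c • opVec.symm x := rfl

lemma par_opVec_iff {x y : m → K} : Par Kᵐᵒᵖ (opVec x) (opVec y) ↔ Par Kᵐᵒᵖ x y :=
  exists_congr fun _ => by rw [← opVec_op_smul, opVec.apply_eq_iff_eq]

lemma par_opVec_iff' {x y : m → K} : Par Kᵐᵒᵖᵐᵒᵖ (opVec x) (opVec y) ↔ Par K x y := by
  constructor
  · rintro ⟨c, hc⟩
    exact ⟨unop (unop c), opVec.injective hc⟩
  · rintro ⟨c, rfl⟩
    exact ⟨op (op c), rfl⟩

lemma adj_opTr {A B : Matrix m n K} (h : Adj A B) : Adj (opTr A) (opTr B) := by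
  obtain ⟨x, v, hx, hv, e⟩ := h
  exact ⟨opVec v, opVec x, opVec_ne_zero.2 hv, opVec_ne_zero.2 hx, by
    rw [← map_sub, e, opTr_tensor]⟩

lemma adj_opTr_symm {A B : Matrix m n Kᵐᵒᵖ} (h : Adj A B) :
    Adj (opTr.symm A) (opTr.symm B) := by
  obtain ⟨x, v, hx, hv, e⟩ := h
  exact ⟨opVec.symm v, opVec.symm x, opVec_symm_ne_zero.2 hv, opVec_symm_ne_zero.2 hx, by
    rw [← map_sub, e, opTr_symm_tensor]⟩

/-- The map induced by `φ` on transposed matrices. -/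
def opConj (φ : Matrix m n D → Matrix p q K) : Matrix n m Dᵐᵒᵖ → Matrix q p Kᵐᵒᵖ :=
  fun N => opTr (φ (opTr.symm N))

lemma shift_opConj (φ : Matrix m n D → Matrix p q K) (A : Matrix n m Dᵐᵒᵖ) :
    shift (opConj φ) A = opConj (shift φ (opTr.symm A)) := by
  funext N
  simp only [shift, opConj, map_add, map_sub]

lemma RegularWith.opConj {φ : Matrix m n D → Matrix p q K} {f : (m → D) → p → K}
    {g : (n → D) → q → K} (R : RegularWith φ f g) :
    RegularWith (opConj φ) (fun y => opVec (g (opVec.symm y)))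
      (fun x => opVec (f (opVec.symm x))) where
  left_ne y hy := opVec_ne_zero.2 (R.right_ne _ (opVec_symm_ne_zero.2 hy))
  right_ne x hx := opVec_ne_zero.2 (R.left_ne _ (opVec_symm_ne_zero.2 hx))
  eq y x hy hx := by
    obtain ⟨c, hc, e⟩ := R.eq _ _ (opVec_symm_ne_zero.2 hx) (opVec_symm_ne_zero.2 hy)
    refine ⟨op c, by simpa using hc, ?_⟩
    rw [AdjacencyPreserver.opConj, opTr_symm_tensor, e, opTr_tensor, opVec_smul, op_smul_tensor]
  left_ex := by
    obtain ⟨y₁, y₂, h1, h2, h⟩ := R.right_ex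
    exact ⟨opVec y₁, opVec y₂, opVec_ne_zero.2 h1, opVec_ne_zero.2 h2,
      fun h' => h (par_opVec_iff'.1 h')⟩
  right_ex := by
    obtain ⟨y₁, y₂, h1, h2, h⟩ := R.left_ex
    exact ⟨opVec y₁, opVec y₂, opVec_ne_zero.2 h1, opVec_ne_zero.2 h2,
      fun h' => h (par_opVec_iff.1 h')⟩

lemma RegularPreserver.opConj {φ : Matrix m n D → Matrix p q K} (h : RegularPreserver φ) :
    RegularPreserver (opConj φ) where
  preserves A B hAB := adj_opTr (h.preserves _ _ (adj_opTr_symm hAB))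
  zero := by rw [AdjacencyPreserver.opConj, map_zero, h.zero, map_zero]
  regular A := by
    obtain ⟨f, g, R⟩ := h.regular (opTr.symm A)
    rw [shift_opConj]
    exact ⟨_, _, R.opConj⟩

lemma surjective_of_op (hS : ∀ f : D →+* K, Function.Surjective f) (f : Dᵐᵒᵖ →+* Kᵐᵒᵖ) :
    Function.Surjective f := fun y => by
  obtain ⟨x, hx⟩ := hS (RingHom.unop f) (unop y)
  exact ⟨op x, unop_injective hx⟩

/-- On a column space of the domain, the map is semilinear. -/
lemma RegularPreserver.exists_semilinear_slice_left {φ : Matrix m n D → Matrix p q K}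
    {f : (m → D) → p → K} {g : (n → D) → q → K} (h : RegularPreserver φ)
    (R : RegularWith φ f g) (hS : ∀ f : D →+* K, Function.Surjective f)
    (hc : Nonempty (D ≃ K)) {y : n → D} (hy : y ≠ 0) :
    ∃ b : (m → D) → p → K, (∀ x, φ (x ⊠ y) = b x ⊠ g y) ∧
      (∀ x, x ≠ 0 → ∃ c : Kᵐᵒᵖ, c ≠ 0 ∧ b x = c • f x) ∧ Function.Injective b ∧
      (∀ x x', b (x + x') = b x + b x') ∧
      ∃ τ : D →+* K, ∀ (s : D) x, b (op s • x) = op (τ s) • b x := by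
  obtain ⟨a, h1, h2, h3, h4, τ, h5⟩ := h.opConj.exists_semilinear_slice R.opConj
    (surjective_of_op hS) (hc.map fun e => opEquiv.symm.trans (e.trans opEquiv))
    (opVec_ne_zero.2 hy)
  refine ⟨fun x => opVec.symm (a (opVec x)), fun x => ?_, fun x hx => ?_, ?_, fun x x' => ?_,
    RingHom.unop τ, fun s x => ?_⟩
  · have := congrArg opTr.symm (h1 (opVec x))
    simpa only [opTr_symm_tensor, AdjacencyPreserver.opConj, AddEquiv.symm_apply_apply] using this
  · obtain ⟨c, hc, e⟩ := h2 _ (opVec_ne_zero.2 hx)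
    exact ⟨c, hc, by beta_reduce; rw [e, AddEquiv.symm_apply_apply, opVec_symm_smul,
      AddEquiv.symm_apply_apply]⟩
  · exact opVec.symm.injective.comp (h3.comp opVec.injective)
  · simp only [map_add, h4]
  · simp only [opVec_op_smul, h5, opVec_symm_smul]
    rfl

end OpTranspose

section Factorization

variable {m n p q : Type*} {D K : Type*} [DivisionRing D] [DivisionRing K]

lemma eq_of_eq_smul {V W : Type*} [AddCommGroup V] [AddCommGroup W] [Module K W]
    {a a' : V → W} (ha : ∀ v w, a (v + w) = a v + a w) (ha' : ∀ v w, a' (v + w) = a' v + a' w)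
    (h : ∀ v, Par K (a v) (a' v)) {v₀ z : V} (hv₀ : a v₀ ≠ 0) (hz : ¬ Par K (a v₀) (a z))
    (h₀ : a' v₀ = a v₀) : a' = a := by
  have step : ∀ {v w}, a v ≠ 0 → ¬ Par K (a v) (a w) → a' v = a v → a' w = a w := by
    intro v w hv hvw e
    obtain ⟨k, hk⟩ := h (v + w)
    obtain ⟨l, hl⟩ := h w
    rw [ha, ha', ← hl, e, smul_add] at hk
    have := eq_zero_of_not_par hv hvw (a := k - 1) (b := k - l) (by
      rw [sub_smul, sub_smul, one_smul, sub_add_sub_comm, hk, sub_self])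
    rw [← hl, ← sub_eq_zero.1 this.2, sub_eq_zero.1 this.1, one_smul]
  funext w
  by_cases hw : a w = 0
  · obtain ⟨k, hk⟩ := h w
    rw [← hk, hw, smul_zero]
  by_cases hp : Par K (a v₀) (a w)
  · exact step (ne_zero_of_not_par_right hz) (fun h' => hz (hp.trans (h'.symm hw)))
      (step hv₀ hz h₀)
  · exact step hv₀ hp h₀

/-- On rank one matrices `φ` is a product of two injective semilinear maps. -/
structure Factors (φ : Matrix m n D → Matrix p q K) (τ : D →+* K) (b : (m → D) → p → K)
    (a : (n → D) → q → K) : Prop where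
  eq : ∀ x v, φ (x ⊠ v) = b x ⊠ a v
  left_add : ∀ x x', b (x + x') = b x + b x'
  right_add : ∀ v v', a (v + v') = a v + a v'
  left_smul : ∀ (s : D) x, b (op s • x) = op (τ s) • b x
  right_smul : ∀ (s : D) v, a (s • v) = τ s • a v
  left_inj : Function.Injective b
  right_inj : Function.Injective a

lemma RegularPreserver.exists_factors {φ : Matrix m n D → Matrix p q K}
    (h : RegularPreserver φ) (hS : ∀ f : D →+* K, Function.Surjective f)
    (hc : Nonempty (D ≃ K)) : ∃ τ b a, Factors φ τ b a := by
  obtain ⟨f, g, R⟩ : Regular φ := by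
    have := h.regular 0
    rwa [show AdjacencyPreserver.shift φ 0 = φ by
      funext M; simp [AdjacencyPreserver.shift, h.zero]] at this
  obtain ⟨y₀, z₀, hy₀, hz₀, hyz⟩ := R.right_ex
  obtain ⟨x₀, x₁, hx₀, hx₁, hxx⟩ := R.left_ex
  obtain ⟨b, b1, b2, b3, b4, τ', b5⟩ := h.exists_semilinear_slice_left R hS hc hy₀
  have hb0 : b 0 = 0 := by simpa using b4 0 0
  have R' : RegularWith φ b g :=
    { left_ne := fun x hx e => hx (b3 (e.trans hb0.symm))
      right_ne := R.right_ne
      eq := fun x y hx hy => by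
        obtain ⟨c, hc, e⟩ := R.eq x y hx hy
        obtain ⟨d, hd, e'⟩ := b2 x hx
        refine ⟨(unop d)⁻¹ * c, mul_ne_zero (inv_ne_zero ((unop_eq_zero_iff d).not.2 hd)) hc, ?_⟩
        rw [e, e', smul_tensor, smul_smul,
          mul_inv_cancel_left₀ ((unop_eq_zero_iff d).not.2 hd)]
      left_ex := by
        obtain ⟨c, hc, e⟩ := b2 _ hx₀
        obtain ⟨d, hd, e'⟩ := b2 _ hx₁
        exact ⟨x₀, x₁, hx₀, hx₁, by rwa [e, e', par_smul_iff hc, par_smul_right_iff hd]⟩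
      right_ex := R.right_ex }
  obtain ⟨a, a1, a2, a3, a4, τ, a5⟩ := h.exists_semilinear_slice R' hS hc hx₀
  have ha0 : a 0 = 0 := by simpa using a4 0 0
  have hav : ∀ v, v ≠ 0 → a v ≠ 0 := fun v hv e => hv (a3 (e.trans ha0.symm))
  have heq : ∀ x v, φ (x ⊠ v) = b x ⊠ a v := by
    intro x v
    by_cases hx : x = 0
    · rw [hx, hb0, zero_tensor, zero_tensor, h.zero]
    obtain ⟨a', a1', a2', a3', a4', -⟩ := h.exists_semilinear_slice R' hS hc hx
    rw [a1', show a' = a from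
      eq_of_eq_smul (K := K) a4 a4' (fun v => ?_) (hav y₀ hy₀) (z := z₀) ?_ ?_]
    · obtain ⟨c, hc, e⟩ := a2 _ hy₀
      obtain ⟨d, hd, e'⟩ := a2 _ hz₀
      rwa [e, e', par_smul_iff hc, par_smul_right_iff hd]
    · rw [tensor_injective_right (R'.left_ne x hx) ((a1' y₀).symm.trans (b1 x)),
        tensor_injective_right (R'.left_ne x₀ hx₀) ((a1 y₀).symm.trans (b1 x₀))]
    · by_cases hv : v = 0
      · rw [hv, show a' 0 = 0 by simpa using a4' 0 0]
        exact Par.zero_right _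
      · obtain ⟨c, hc, e⟩ := a2 v hv
        obtain ⟨d, hd, e'⟩ := a2' v hv
        rw [e, e', par_smul_iff hc, par_smul_right_iff hd]
        exact Par.rfl'
  have hτ : τ' = τ := by
    ext s
    have e := heq (op s • x₀) y₀
    rw [b5, op_smul_tensor, op_smul_tensor, heq, a5] at e
    exact (smul_left_injective K (hav y₀ hy₀)
      (tensor_injective_right (R'.left_ne x₀ hx₀) e)).symm
  exact ⟨τ, b, a, heq, b4, a4, hτ ▸ b5, a5, b3, a3⟩

end Factorization

section Gluing

variable {m n p q : Type*} {D K : Type*} [DivisionRing D] [DivisionRing K]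

lemma Factors.left_zero {φ : Matrix m n D → Matrix p q K} {τ : D →+* K} {b : (m → D) → p → K}
    {a : (n → D) → q → K} (F : Factors φ τ b a) : b 0 = 0 := by simpa using F.left_add 0 0

lemma Factors.right_zero {φ : Matrix m n D → Matrix p q K} {τ : D →+* K} {b : (m → D) → p → K}
    {a : (n → D) → q → K} (F : Factors φ τ b a) : a 0 = 0 := by simpa using F.right_add 0 0

lemma RegularPreserver.shift_tensor {φ : Matrix m n D → Matrix p q K}
    (h : RegularPreserver φ) (hS : ∀ f : D →+* K, Function.Surjective f)
    (hc : Nonempty (D ≃ K)) (x₀ : m → D) (v₀ : n → D) (x : m → D) (v : n → D) :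
    AdjacencyPreserver.shift φ (x₀ ⊠ v₀) (x ⊠ v) = φ (x ⊠ v) := by
  by_cases hx₀ : x₀ = 0
  · simp [AdjacencyPreserver.shift, hx₀, h.zero]
  by_cases hv₀ : v₀ = 0
  · simp [AdjacencyPreserver.shift, hv₀, h.zero]
  obtain ⟨τ, b, a, F⟩ := h.exists_factors hS hc
  obtain ⟨τ', b', a', F'⟩ := (h.shift (x₀ ⊠ v₀)).exists_factors hS hc
  have hb0 : b x₀ ≠ 0 := fun e => hx₀ (F.left_inj (e.trans F.left_zero.symm))
  have ha0 : a v₀ ≠ 0 := fun e => hv₀ (F.right_inj (e.trans F.right_zero.symm))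
  have h1 : ∀ v, b' x₀ ⊠ a' v = b x₀ ⊠ a v := fun v => by
    rw [← F'.eq, AdjacencyPreserver.shift, ← Matrix.vecMulVec_add, F.eq, F.eq, F.right_add,
      Matrix.vecMulVec_add, add_sub_cancel_left]
  have h2 : ∀ x, b' x ⊠ a' v₀ = b x ⊠ a v₀ := fun x => by
    rw [← F'.eq, AdjacencyPreserver.shift, ← Matrix.add_vecMulVec, F.eq, F.eq, F.left_add,
      Matrix.add_vecMulVec, add_sub_cancel_left]
  obtain ⟨⟨c, hc'⟩, ⟨d, hd⟩⟩ := par_of_tensor_eq hb0 ha0 (h1 v₀).symm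
  have h3 : b' x₀ ≠ 0 := by
    rintro e
    rw [e, smul_zero] at hc'
    exact hb0 hc'.symm
  have h4 : a' v₀ ≠ 0 := by
    rintro e
    rw [e, smul_zero] at hd
    exact ha0 hd.symm
  have hdc : d * unop c = 1 := by
    have := h1 v₀
    rw [← hc', ← hd, smul_tensor] at this
    have h5 := tensor_injective_right h3 this
    rw [smul_smul] at h5
    have h6 : unop c * d = 1 := smul_left_injective K h4 (by simpa using h5.symm)
    exact mul_eq_one_comm.1 h6
  have ha : ∀ v, a' v = unop c • a v := fun v => by
    have := h1 v
    rw [← hc', smul_tensor] at this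
    exact tensor_injective_right h3 this
  have hb : ∀ x, b' x = op d • b x := fun x => by
    have := h2 x
    rw [← hd, ← op_smul_tensor] at this
    exact tensor_injective_left h4 this
  rw [F'.eq, F.eq, ha, hb, op_smul_tensor, smul_smul, hdc, one_smul]

variable [Fintype m] [Fintype n]

lemma RegularPreserver.shift_apply_tensor {φ : Matrix m n D → Matrix p q K}
    (h : RegularPreserver φ) (hS : ∀ f : D →+* K, Function.Surjective f)
    (hc : Nonempty (D ≃ K)) (A : Matrix m n D) (x : m → D) (v : n → D) :
    AdjacencyPreserver.shift φ A (x ⊠ v) = φ (x ⊠ v) := by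
  classical
  induction A using Matrix.induction_on' generalizing φ with
  | h_zero => simp [AdjacencyPreserver.shift, h.zero]
  | h_add A B hA hB => rw [← shift_shift, hB (h.shift A), hA h]
  | h_std_basis i j r => rw [single_eq_tensor, h.shift_tensor hS hc]

lemma RegularPreserver.map_add {φ : Matrix m n D → Matrix p q K}
    (h : RegularPreserver φ) (hS : ∀ f : D →+* K, Function.Surjective f)
    (hc : Nonempty (D ≃ K)) (A B : Matrix m n D) : φ (A + B) = φ A + φ B := by
  classical
  induction B using Matrix.induction_on' generalizing A with
  | h_zero => simp [h.zero]
  | h_add B C hB hC => rw [← add_assoc, hC, hB, hC B, add_assoc]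
  | h_std_basis i j r =>
    have := h.shift_apply_tensor hS hc A (Pi.single i r) (Pi.single j 1)
    rw [← single_eq_tensor, AdjacencyPreserver.shift] at this
    rw [← this, add_sub_cancel]

/-- A regular preserver fixing zero is given by matrix multiplications and a homomorphism. -/
theorem RegularPreserver.exists_eq_mul {φ : Matrix m n D → Matrix p q K}
    (h : RegularPreserver φ) (hS : ∀ f : D →+* K, Function.Surjective f)
    (hc : Nonempty (D ≃ K)) : ∃ (τ : D →+* K) (C : Matrix p m K) (R : Matrix n q K),
      Function.Injective C.mulVec ∧ Function.Injective R.vecMul ∧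
        ∀ M, φ M = C * M.map τ * R := by
  classical
  obtain ⟨τ, b, a, F⟩ := h.exists_factors hS hc
  let bh : (m → D) →+ p → K := ⟨⟨b, F.left_zero⟩, F.left_add⟩
  let ah : (n → D) →+ q → K := ⟨⟨a, F.right_zero⟩, F.right_add⟩
  let φh : Matrix m n D →+ Matrix p q K := ⟨⟨φ, h.zero⟩, h.map_add hS hc⟩
  refine ⟨τ, Matrix.of fun k i => b (Pi.single i 1) k, Matrix.of fun j l => a (Pi.single j 1) l,
    ?_, ?_, fun M => ?_⟩
  · have key : ∀ y : m → D, (Matrix.of fun k i => b (Pi.single i 1) k) *ᵥ (τ ∘ y) = b y := by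
      intro y
      have hy : y = ∑ i, op (y i) • Pi.single i (1 : D) := by
        simp only [← Pi.single_smul, op_smul_eq_mul, one_mul]
        exact (Finset.univ_sum_single y).symm
      have e : b y = ∑ i, bh (op (y i) • Pi.single i (1 : D)) := by
        rw [← map_sum, ← hy]; rfl
      rw [e]
      funext k
      rw [Finset.sum_apply]
      exact Finset.sum_congr rfl fun i _ => (congrFun (F.left_smul (y i) (Pi.single i 1)) k).symm
    intro x x' e
    obtain ⟨y, rfl⟩ := (hS τ).comp_left x
    obtain ⟨y', rfl⟩ := (hS τ).comp_left x'
    simp only [key] at e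
    rw [F.left_inj e]
  · have key : ∀ y : n → D, (τ ∘ y) ᵥ* (Matrix.of fun j l => a (Pi.single j 1) l) = a y := by
      intro y
      have hy : y = ∑ i, y i • Pi.single i (1 : D) := by
        simp only [← Pi.single_smul, smul_eq_mul, mul_one]
        exact (Finset.univ_sum_single y).symm
      have e : a y = ∑ i, ah (y i • Pi.single i (1 : D)) := by
        rw [← map_sum, ← hy]; rfl
      rw [e]
      funext k
      rw [Finset.sum_apply]
      exact Finset.sum_congr rfl fun i _ => (congrFun (F.right_smul (y i) (Pi.single i 1)) k).symm
    intro x x' e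
    obtain ⟨y, rfl⟩ := (hS τ).comp_left x
    obtain ⟨y', rfl⟩ := (hS τ).comp_left x'
    simp only [key] at e
    rw [F.right_inj e]
  · have e : φ M = ∑ i, ∑ j, φh (Matrix.single i j (M i j)) := by
      simp only [← map_sum]
      rw [← Matrix.matrix_eq_sum_single]; rfl
    have e' : ∀ i j, φh (Matrix.single i j (M i j)) =
        b (Pi.single i 1) ⊠ (τ (M i j) • a (Pi.single j 1)) := by
      intro i j
      change φ _ = _
      have e3 : (Pi.single i (M i j) : m → D) = op (M i j) • Pi.single i 1 := by
        rw [← Pi.single_smul, op_smul_eq_mul, one_mul]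
      rw [single_eq_tensor, F.eq, e3, F.left_smul, op_smul_tensor]
    rw [e]
    simp only [e']
    ext k l
    simp only [Matrix.sum_apply, Matrix.vecMulVec_apply, Matrix.mul_apply, Matrix.map_apply,
      Matrix.of_apply, Pi.smul_apply, smul_eq_mul, Finset.sum_mul, mul_assoc]
    exact Finset.sum_comm

end Gluing

section Completion

variable {K : Type*} [DivisionRing K]

lemma isUnit_of_basis {q : ℕ} (b : Module.Basis (Fin q) K (Fin q → K)) :
    IsUnit (Matrix.of fun i => b i) := by
  have h : (Matrix.of fun i j => b.repr (Pi.single i 1) j) * (Matrix.of fun i => b i) = 1 := by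
    ext i j
    have := congrFun (b.sum_repr (Pi.single i 1)) j
    rw [Finset.sum_apply] at this
    rw [Matrix.mul_apply, Matrix.one_apply, Pi.single_comm] at *
    rw [Pi.single_apply] at this
    simpa [eq_comm] using this
  exact .of_mul_eq_one _ (mul_eq_one_comm.1 h)

lemma exists_isUnit_rows {n q : ℕ} (R : Matrix (Fin n) (Fin q) K)
    (hR : Function.Injective R.vecMul) :
    n ≤ q ∧ ∃ S : Matrix (Fin q) (Fin q) K, IsUnit S ∧
      ∀ {p : ℕ} (N : Matrix (Fin p) (Fin n) K), pad p q N * S = N * R := by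
  have hli : LinearIndependent K R.row := Matrix.vecMul_injective_iff.1 hR
  have hnq : n ≤ q := by simpa using hli.fintype_card_le_finrank
  refine ⟨hnq, ?_⟩
  obtain ⟨k, rfl⟩ := Nat.exists_eq_add_of_le hnq
  let B := Module.Basis.sumExtend hli
  have hB : ∀ i, B (Sum.inl i) = R i := fun i => by
    simp [B, Module.Basis.sumExtend, Trans.trans]
    rfl
  have : Finite (Fin n ⊕ Module.Basis.sumExtendIndex hli) := Module.Finite.finite_basis B
  have : Finite (Module.Basis.sumExtendIndex hli) := Finite.sum_right (Fin n)
  have hcard : Nat.card (Module.Basis.sumExtendIndex hli) = k := by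
    have := Module.finrank_eq_nat_card_basis B
    rw [Nat.card_sum, Nat.card_fin, Module.finrank_fin_fun] at this
    exact (Nat.add_left_cancel this).symm
  let e : Fin n ⊕ Module.Basis.sumExtendIndex hli ≃ Fin (n + k) :=
    ((Equiv.refl _).sumCongr (Finite.equivFinOfCardEq hcard)).trans finSumFinEquiv
  have he : ∀ i, (B.reindex e) (Fin.castAdd k i) = R i := fun i => by
    rw [Module.Basis.reindex_apply, ← hB, Equiv.symm_apply_eq _ |>.2]
    rfl
  refine ⟨_, isUnit_of_basis (B.reindex e), fun N => ?_⟩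
  ext i j
  simp [Matrix.mul_apply, Fin.sum_univ_add, pad, he, -Module.Basis.coe_reindex]

lemma opTr_apply {m n : Type*} (A : Matrix m n K) (i : m) (j : n) : opTr A j i = op (A i j) := rfl

lemma opTr_symm_apply {m n : Type*} (A : Matrix m n Kᵐᵒᵖ) (i : m) (j : n) :
    opTr.symm A j i = unop (A i j) := rfl

lemma opTr_mul {m n p : Type*} [Fintype n] (A : Matrix m n K) (B : Matrix n p K) :
    opTr (A * B) = opTr B * opTr A := by
  ext i j
  simp [opTr_apply, Matrix.mul_apply]

lemma opTr_symm_mul {m n p : Type*} [Fintype n] (A : Matrix m n Kᵐᵒᵖ) (B : Matrix n p Kᵐᵒᵖ) :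
    opTr.symm (A * B) = opTr.symm B * opTr.symm A := by
  rw [AddEquiv.symm_apply_eq, opTr_mul, AddEquiv.apply_symm_apply, AddEquiv.apply_symm_apply]

lemma opTr_symm_one {n : Type*} [DecidableEq n] :
    opTr.symm (1 : Matrix n n Kᵐᵒᵖ) = 1 := by
  ext i j
  simp [opTr_symm_apply, Matrix.one_apply, eq_comm, apply_ite unop]

lemma isUnit_opTr_symm {n : Type*} [Fintype n] [DecidableEq n] {A : Matrix n n Kᵐᵒᵖ}
    (h : IsUnit A) : IsUnit (opTr.symm A) := by
  obtain ⟨⟨A, B, h₁, h₂⟩, rfl⟩ := h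
  exact ⟨⟨opTr.symm A, opTr.symm B, by rw [← opTr_symm_mul, h₂, opTr_symm_one],
    by rw [← opTr_symm_mul, h₁, opTr_symm_one]⟩, rfl⟩

lemma opTr_pad {m n p q : ℕ} (N : Matrix (Fin m) (Fin n) K) :
    opTr (pad p q N) = pad q p (opTr N) := by
  ext i j
  simp only [opTr_apply, pad, Matrix.of_apply]
  split_ifs <;> rfl

lemma exists_isUnit_cols {m p : ℕ} (C : Matrix (Fin p) (Fin m) K)
    (hC : Function.Injective C.mulVec) :
    m ≤ p ∧ ∃ T : Matrix (Fin p) (Fin p) K, IsUnit T ∧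
      ∀ {n : ℕ} (N : Matrix (Fin m) (Fin n) K), T * pad p n N = C * N := by
  obtain ⟨h, S, hS, e⟩ := exists_isUnit_rows (opTr C) fun x y hxy => by
    refine opVec.symm.injective (hC ?_)
    funext i
    have := congrArg unop (congrFun hxy i)
    simp only [Matrix.vecMul, dotProduct, opTr_apply, Finset.unop_sum, unop_mul, unop_op] at this
    exact this
  refine ⟨h, opTr.symm S, isUnit_opTr_symm hS, fun N => opTr.injective ?_⟩
  rw [opTr_mul, opTr_mul, AddEquiv.apply_symm_apply, opTr_pad, e]

lemma exists_isUnit_pad {m n p q : ℕ} (C : Matrix (Fin p) (Fin m) K)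
    (R : Matrix (Fin n) (Fin q) K) (hC : Function.Injective C.mulVec)
    (hR : Function.Injective R.vecMul) :
    m ≤ p ∧ n ≤ q ∧ ∃ (T : Matrix (Fin p) (Fin p) K) (S : Matrix (Fin q) (Fin q) K),
      IsUnit T ∧ IsUnit S ∧ ∀ N : Matrix (Fin m) (Fin n) K, C * N * R = T * pad p q N * S := by
  obtain ⟨hm, T, hT, eT⟩ := exists_isUnit_cols C hC
  obtain ⟨hn, S, hS, eS⟩ := exists_isUnit_rows R hR
  refine ⟨hm, hn, T, S, hT, hS, fun N => ?_⟩
  have : pad p q N = pad p q (pad p n N) := by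
    ext i j
    simp only [pad, Matrix.of_apply, Fin.is_lt, dite_true]
    split_ifs <;> rfl
  rw [← eT, Matrix.mul_assoc, ← eS, ← this, Matrix.mul_assoc]

end Completion

section Main

lemma exists_eq_tensor_of_rowRank_le {m n : ℕ} {M : Matrix (Fin m) (Fin n) D} (h : rowRank M ≤ 1) :
    ∃ x v, M = x ⊠ v := by
  obtain ⟨⟨v, hv'⟩, hv⟩ := finrank_le_one_iff.1 h
  choose x hx using fun i => hv ⟨M i, Submodule.subset_span ⟨i, rfl⟩⟩
  exact ⟨x, v, funext fun i => (congrArg Subtype.val (hx i)).symm⟩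

lemma rowRank_tensor {m n : ℕ} {x : Fin m → D} {v : Fin n → D} (hx : x ≠ 0) (hv : v ≠ 0) :
    rowRank (x ⊠ v) = 1 := by
  obtain ⟨i, hi⟩ := Function.ne_iff.1 hx
  rw [rowRank, show Submodule.span D (Set.range fun i => (x ⊠ v) i) = Submodule.span D {v} from
    le_antisymm (Submodule.span_le.2 ?_) (Submodule.span_le.2 ?_), finrank_span_singleton hv]
  · rintro _ ⟨j, rfl⟩
    exact Submodule.mem_span_singleton.2 ⟨x j, rfl⟩
  · refine Set.singleton_subset_iff.2 ?_
    have : x i • v ∈ Submodule.span D (Set.range fun i => (x ⊠ v) i) :=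
      Submodule.subset_span ⟨i, rfl⟩
    exact (Submodule.smul_mem_iff _ hi).1 this

lemma adjacent_iff_adj {m n : ℕ} {A B : Matrix (Fin m) (Fin n) D} :
    Adjacent A B ↔ Adj A B := by
  constructor
  · intro h
    obtain ⟨x, v, e⟩ := exists_eq_tensor_of_rowRank_le h.le
    have h0 : A - B ≠ 0 := fun e => by
      rw [Adjacent, e, rowRank] at h
      have : (Set.range fun i => (0 : Matrix (Fin m) (Fin n) D) i) ⊆ {0} := by
        rintro _ ⟨i, rfl⟩; rfl
      rw [Submodule.span_eq_bot.2 fun x hx => this hx, finrank_bot] at h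
      exact zero_ne_one h
    refine ⟨x, v, ?_, ?_, e⟩ <;> rintro rfl <;> simp [e] at h0
  · rintro ⟨x, v, hx, hv, e⟩
    rw [Adjacent, e, rowRank_tensor hx hv]

lemma degenerateAt_of_crossLike {m n p q : ℕ}
    {φ : Matrix (Fin m) (Fin n) D → Matrix (Fin p) (Fin q) D} {A : Matrix (Fin m) (Fin n) D}
    (h : CrossLike (shift φ A)) : DegenerateAt φ A := by
  obtain ⟨ξ, hξ, η, hη, H⟩ := h
  refine ⟨ξ, hξ, η, hη, fun M hM => ?_⟩
  obtain ⟨x, v, rfl⟩ := exists_eq_tensor_of_rowRank_le hM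
  rcases H x v with ⟨w, e⟩ | ⟨u, e⟩
  · exact Or.inr ⟨w, fun i j => congrFun (congrFun e i) j⟩
  · exact Or.inl ⟨u, fun i j => congrFun (congrFun e i) j⟩

variable {m n p q : Type*} {K : Type*} [DivisionRing K]

lemma TransRegularWith.opTr {φ : Matrix m n D → Matrix p q K} {f : (m → D) → q → K}
    {g : (n → D) → p → K} (R : TransRegularWith φ f g) :
    RegularWith (fun M => opTr (φ M)) (fun x => opVec (f x)) (fun y => opVec (g y)) where
  left_ne x hx := opVec_ne_zero.2 (R.left_ne x hx)
  right_ne y hy := opVec_ne_zero.2 (R.right_ne y hy)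
  eq x y hx hy := by
    obtain ⟨c, hc, e⟩ := R.eq x y hx hy
    exact ⟨op c, by simpa using hc, by rw [e, opTr_tensor, opVec_smul, op_smul_tensor]⟩
  left_ex := by
    obtain ⟨y₁, y₂, h1, h2, h⟩ := R.left_ex
    exact ⟨y₁, y₂, h1, h2, fun h' => h (par_opVec_iff'.1 h')⟩
  right_ex := by
    obtain ⟨y₁, y₂, h1, h2, h⟩ := R.right_ex
    exact ⟨y₁, y₂, h1, h2, fun h' => h (par_opVec_iff.1 h')⟩

lemma Regular.regularPreserver [Finite m] [Finite n] {φ : Matrix m n D → Matrix p q K}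
    (R : Regular φ) (hφ : Preserves φ) (h0 : φ 0 = 0) (hc : Nonempty (D ≃ K)) :
    RegularPreserver φ where
  preserves := hφ
  zero := h0
  regular := R.shift hφ h0 (two_of_equiv hc)

/-- A matrix version of `RegularPreserver.exists_eq_mul` with square invertible factors. -/
lemma RegularPreserver.exists_eq_pad {m n p q : ℕ}
    {φ : Matrix (Fin m) (Fin n) D → Matrix (Fin p) (Fin q) K} (h : RegularPreserver φ)
    (hS : ∀ f : D →+* K, Function.Surjective f) (hc : Nonempty (D ≃ K)) :
    m ≤ p ∧ n ≤ q ∧ ∃ (τ : D →+* K) (T : Matrix (Fin p) (Fin p) K) (S : Matrix (Fin q) (Fin q) K),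
      IsUnit T ∧ IsUnit S ∧ ∀ M, φ M = T * pad p q (M.map τ) * S := by
  obtain ⟨τ, C, R, hC, hR, e⟩ := h.exists_eq_mul hS hc
  obtain ⟨hm, hn, T, S, hT, hS, e'⟩ := exists_isUnit_pad C R hC hR
  exact ⟨hm, hn, τ, T, S, hT, hS, fun M => by rw [e, e']⟩

lemma pad_sub {m n p q : ℕ} (M N : Matrix (Fin m) (Fin n) K) :
    pad p q (M - N) = pad p q M - pad p q N := by
  ext i j
  simp only [pad, Matrix.of_apply, Matrix.sub_apply]
  split_ifs <;> simp

lemma surjective_op_of_eas (hEAS : EAS D) (f : D →+* Dᵐᵒᵖ) : Function.Surjective f := by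
  intro y
  let g : D →+* D :=
    { toFun := fun d => unop (f (unop (f d)))
      map_one' := by simp
      map_mul' := by simp
      map_zero' := by simp
      map_add' := by simp }
  obtain ⟨x, hx⟩ := hEAS g (unop y)
  exact ⟨unop (f x), unop_injective hx⟩

end Main

end AdjacencyPreserver

open AdjacencyPreserver MulOpposite

/-- Theorem 1.2, main theorem. Let `m, n, p, q` be positive integers,
`D` an EAS division ring, and `φ : M_{m×n}(D) → M_{p×q}(D)` an adjacency preserver.
Then `φ` is either degenerate or standard. -/
theorem stmt0 (hEAS : EAS D) (m n p q : ℕ) (hm : 0 < m) (hn : 0 < n) (hp : 0 < p)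
    (hq : 0 < q) (φ : Matrix (Fin m) (Fin n) D → Matrix (Fin p) (Fin q) D)
    (hφ : ∀ A B, Adjacent A B → Adjacent (φ A) (φ B)) :
    Degenerate φ ∨ Standard φ := by
  have := Fin.pos_iff_nonempty.1 hm
  have := Fin.pos_iff_nonempty.1 hn
  refine or_iff_not_imp_left.2 fun hdeg => ?_
  obtain ⟨A₀, hA₀⟩ := not_forall.1 hdeg
  have hP : Preserves (shift φ A₀) :=
    Preserves.shift (fun A B h => adjacent_iff_adj.1 (hφ A B (adjacent_iff_adj.2 h))) A₀
  have h0 : shift φ A₀ 0 = 0 := shift_zero φ A₀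
  have eφ : ∀ M, φ M = shift φ A₀ (M - A₀) + φ A₀ := fun M => by simp [shift]
  rcases hP.classify h0 with h | h | ⟨f, g, h⟩
  · exact (hA₀ (degenerateAt_of_crossLike h)).elim
  · obtain ⟨hm, hn, τ, T, S, hT, hS, e⟩ :=
      (h.regularPreserver hP h0 ⟨Equiv.refl D⟩).exists_eq_pad hEAS ⟨Equiv.refl D⟩
    refine Or.inl ⟨hm, hn, RingEquiv.ofBijective τ ⟨τ.injective, hEAS τ⟩, T, S,
      φ A₀ - shift φ A₀ A₀, hT, hS, fun M => ?_⟩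
    change _ = T * pad p q (M.map τ) * S + _
    rw [eφ M, e, e, Matrix.map_sub, pad_sub, Matrix.mul_sub, Matrix.sub_mul]
    · abel
    · exact map_sub τ
  · have hc : Nonempty (D ≃ Dᵐᵒᵖ) := ⟨opEquiv⟩
    have hR : RegularPreserver fun M => opTr (shift φ A₀ M) :=
      Regular.regularPreserver ⟨_, _, h.opTr⟩ (fun A B hAB => adj_opTr (hP A B hAB))
        (by rw [h0, map_zero]) hc
    have hS := surjective_op_of_eas hEAS
    obtain ⟨hm, hn, τ, T, S, hT, hS', e⟩ := hR.exists_eq_pad hS hc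
    have e' : ∀ M, shift φ A₀ M =
        opTr.symm S * pad p q (M.map fun d => unop (τ d)).transpose * opTr.symm T := fun M => by
      refine opTr.injective ((e M).trans ?_)
      rw [opTr_mul, opTr_mul, AddEquiv.apply_symm_apply, AddEquiv.apply_symm_apply, opTr_pad,
        Matrix.mul_assoc]
      rfl
    refine Or.inr ⟨hn, hm, fun d => unop (τ d), unop_bijective.comp ⟨τ.injective, hS τ⟩,
      by simp, by simp, by simp, _, _, φ A₀ - shift φ A₀ A₀, isUnit_opTr_symm hS',
      isUnit_opTr_symm hT, fun M => ?_⟩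
    rw [eφ M, e', e', Matrix.map_sub, Matrix.transpose_sub, pad_sub, Matrix.mul_sub, Matrix.sub_mul]
    · abel
    · simp
end

section
/- Let F be a finite field, let m, n, p, q be positive integers, and let φ : M_{m×n}(F) → M_{p×q}(F) be a degenerate adjacency preserver. Then the range of φ is an adjacent set, i.e. any two distinct matrices in the range of φ are adjacent. -/
open Matrix

variable {D : Type*} [DivisionRing D]

section RankOne

variable {F : Type*} [Field F] {m n p q : ℕ}

lemma exists_vecMulVec_of_rowRank_le_one {M : Matrix (Fin m) (Fin n) F} (h : rowRank M ≤ 1) :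
    ∃ u v, M = vecMulVec u v := by
  obtain ⟨v, hv⟩ := finrank_le_one_iff.1 h
  choose u hu using fun i => hv ⟨M i, Submodule.subset_span ⟨i, rfl⟩⟩
  refine ⟨u, v, ?_⟩
  ext i j
  have := congrFun (congrArg Subtype.val (hu i)) j
  simpa [vecMulVec_apply] using this.symm

lemma vecMulVec_zero_right (u : Fin m → F) : vecMulVec u (0 : Fin n → F) = 0 := by
  ext i j
  simp [vecMulVec_apply]

lemma rowRank_vecMulVec_le_one (u : Fin m → F) (v : Fin n → F) :
    rowRank (vecMulVec u v) ≤ 1 := by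
  have hle : Submodule.span F (Set.range fun i => vecMulVec u v i) ≤ Submodule.span F {v} := by
    rw [Submodule.span_le]
    rintro _ ⟨i, rfl⟩
    exact Submodule.mem_span_singleton.2 ⟨u i, by ext j; simp [vecMulVec_apply]⟩
  refine (Submodule.finrank_mono hle).trans ?_
  simpa using finrank_span_le_card (R := F) ({v} : Set (Fin n → F))

lemma rowRank_eq_zero_iff {M : Matrix (Fin m) (Fin n) F} : rowRank M = 0 ↔ M = 0 := by
  unfold rowRank
  rw [Submodule.finrank_eq_zero, Submodule.span_eq_bot]
  constructor
  · intro h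
    ext i j
    exact congrFun (h (M i) ⟨i, rfl⟩) j
  · rintro rfl _ ⟨i, rfl⟩
    rfl

lemma adjacent_iff {A B : Matrix (Fin m) (Fin n) F} :
    Adjacent A B ↔ A ≠ B ∧ ∃ u v, A - B = vecMulVec u v := by
  unfold Adjacent
  constructor
  · intro h
    refine ⟨?_, exists_vecMulVec_of_rowRank_le_one h.le⟩
    rintro rfl
    rw [sub_self, rowRank_eq_zero_iff.2 rfl] at h
    exact zero_ne_one h
  · rintro ⟨hne, u, v, h⟩
    have h0 : rowRank (A - B) ≠ 0 := fun h0 => hne (sub_eq_zero.1 (rowRank_eq_zero_iff.1 h0))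
    have h1 : rowRank (A - B) ≤ 1 := h ▸ rowRank_vecMulVec_le_one u v
    omega

lemma Rvec_sub {y : Fin n → F} {M N : Matrix (Fin m) (Fin n) F}
    (hM : M ∈ Rvec y) (hN : N ∈ Rvec y) : M - N ∈ Rvec y := by
  obtain ⟨u, hu⟩ := hM
  obtain ⟨v, hv⟩ := hN
  exact ⟨u - v, fun i j => by simp [hu, hv, sub_mul]⟩

lemma Lvec_sub {x : Fin m → F} {M N : Matrix (Fin m) (Fin n) F}
    (hM : M ∈ Lvec x) (hN : N ∈ Lvec x) : M - N ∈ Lvec x := by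
  obtain ⟨u, hu⟩ := hM
  obtain ⟨v, hv⟩ := hN
  exact ⟨u - v, fun i j => by simp [hu, hv, mul_sub]⟩

lemma Rvec_le_of_mem {y y' : Fin n → F} {M : Matrix (Fin m) (Fin n) F} (hM : M ≠ 0)
    (h : M ∈ Rvec y) (h' : M ∈ Rvec y') :
    (Rvec y' : Set (Matrix (Fin p) (Fin n) F)) ⊆ Rvec y := by
  obtain ⟨u, hu⟩ := h
  obtain ⟨u', hu'⟩ := h'
  obtain ⟨i, hi⟩ : ∃ i, u' i ≠ 0 := by
    by_contra! hc
    exact hM (by ext i j; simp [hu', hc])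
  rintro N ⟨w, hw⟩
  refine ⟨fun k => w k * (u' i)⁻¹ * u i, fun k j => ?_⟩
  have := (hu i j).symm.trans (hu' i j)
  rw [hw, mul_assoc _ (u i), this]
  field_simp

lemma Lvec_le_of_mem {x x' : Fin m → F} {M : Matrix (Fin m) (Fin n) F} (hM : M ≠ 0)
    (h : M ∈ Lvec x) (h' : M ∈ Lvec x') :
    (Lvec x' : Set (Matrix (Fin m) (Fin q) F)) ⊆ Lvec x := by
  obtain ⟨v, hv⟩ := h
  obtain ⟨v', hv'⟩ := h'
  obtain ⟨j, hj⟩ : ∃ j, v' j ≠ 0 := by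
    by_contra! hc
    exact hM (by ext i j; simp [hv', hc])
  rintro N ⟨w, hw⟩
  refine ⟨fun k => v j * (v' j)⁻¹ * w k, fun i k => ?_⟩
  have := (hv i j).symm.trans (hv' i j)
  rw [hw, ← mul_assoc, ← mul_assoc, this]
  field_simp

lemma exists_smul_of_mem_Rvec_of_mem_Lvec {x : Fin m → F} {y : Fin n → F} (hy : y ≠ 0)
    {M : Matrix (Fin m) (Fin n) F} (hR : M ∈ Rvec y) (hL : M ∈ Lvec x) :
    ∃ c : F, c • vecMulVec x y = M := by
  obtain ⟨u, hu⟩ := hR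
  obtain ⟨v, hv⟩ := hL
  obtain ⟨j, hj⟩ := Function.ne_iff.1 hy
  refine ⟨v j * (y j)⁻¹, ?_⟩
  ext i k
  have := (hu i j).symm.trans (hv i j)
  simp only [Pi.zero_apply] at hj
  have hui : u i = x i * v j * (y j)⁻¹ := by rw [← this]; field_simp
  simp only [Matrix.smul_apply, vecMulVec_apply, smul_eq_mul, hu, hui]
  ring

lemma mem_Rvec_or_mem_Lvec_of_sub_eq {x : Fin m → F} {y : Fin n → F} (hx : x ≠ 0) (hy : y ≠ 0)
    {M N : Matrix (Fin m) (Fin n) F} (hM : M ∈ Lvec x) (hN : N ∈ Rvec y)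
    {w : Fin m → F} {z : Fin n → F} (h : M - N = vecMulVec w z) : M ∈ Rvec y ∨ N ∈ Lvec x := by
  obtain ⟨v, hv⟩ := hM
  obtain ⟨u, hu⟩ := hN
  have key (i j) : x i * v j - u i * y j = w i * z j := by
    rw [← hv, ← hu]
    exact congrFun (congrFun h i) j
  obtain ⟨i, hi⟩ := Function.ne_iff.1 hx
  obtain ⟨j, hj⟩ := Function.ne_iff.1 hy
  simp only [Pi.zero_apply] at hi hj
  have minor (k l) : (x i * u k - u i * x k) * (v j * y l - v l * y j) = 0 := by
    linear_combination (-(x k * v l - u k * y l)) * key i j - w i * z j * key k l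
      + (x k * v j - u k * y j) * key i l + w i * z l * key k j
  by_cases hc : ∀ l, v j * y l - v l * y j = 0
  · left
    refine ⟨fun k => x k * v j * (y j)⁻¹, fun k l => ?_⟩
    rw [hv]
    field_simp
    linear_combination (-x k) * hc l
  · right
    push Not at hc
    obtain ⟨l, hl⟩ := hc
    refine ⟨fun t => u i * (x i)⁻¹ * y t, fun k t => ?_⟩
    have := (mul_eq_zero.1 (minor k l)).resolve_right hl
    rw [hu]
    field_simp
    linear_combination (y t) * this

lemma card_le_of_injOn_line [Fintype F] {ι : Type*} (s : Finset ι)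
    (g : ι → Matrix (Fin m) (Fin n) F) (hg : Set.InjOn g s) {x : Fin m → F} {y : Fin n → F}
    (hy : y ≠ 0) (hR : ∀ i ∈ s, g i ∈ Rvec y) (hL : ∀ i ∈ s, g i ∈ Lvec x) :
    s.card ≤ Fintype.card F := by
  classical
  rw [← Finset.card_image_of_injOn hg, ← Finset.card_univ]
  refine (Finset.card_le_card (t := Finset.univ.image fun c : F => c • vecMulVec x y) ?_).trans
    Finset.card_image_le
  intro M hM
  obtain ⟨i, hi, rfl⟩ := Finset.mem_image.1 hM
  obtain ⟨c, hc⟩ := exists_smul_of_mem_Rvec_of_mem_Lvec hy (hR i hi) (hL i hi)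
  exact Finset.mem_image.2 ⟨c, Finset.mem_univ c, hc⟩

lemma two_mul_card_le_card_pi [Fintype F] (hm : 2 ≤ m) :
    2 * Fintype.card F ≤ Fintype.card (Fin m → F) := by
  have h1 : 1 < Fintype.card F := Fintype.one_lt_card
  rw [Fintype.card_fun, Fintype.card_fin]
  calc 2 * Fintype.card F ≤ Fintype.card F ^ 2 := by nlinarith
    _ ≤ _ := Nat.pow_le_pow_right h1.le hm

/-- A subgroup of matrices of the form `R(y)` or `L(ᵗx)`. -/
def IsRankOneSpace (K : Set (Matrix (Fin m) (Fin n) F)) : Prop :=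
  (∃ y, y ≠ 0 ∧ K = Rvec y) ∨ ∃ x, x ≠ 0 ∧ K = Lvec x

lemma IsRankOneSpace.sub_mem {K : Set (Matrix (Fin m) (Fin n) F)} (hK : IsRankOneSpace K)
    {M N : Matrix (Fin m) (Fin n) F} (hM : M ∈ K) (hN : N ∈ K) : M - N ∈ K := by
  rcases hK with ⟨y, -, rfl⟩ | ⟨x, -, rfl⟩
  · exact Rvec_sub hM hN
  · exact Lvec_sub hM hN

lemma IsRankOneSpace.exists_vecMulVec {K : Set (Matrix (Fin m) (Fin n) F)}
    (hK : IsRankOneSpace K) {M : Matrix (Fin m) (Fin n) F} (hM : M ∈ K) :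
    ∃ u v, M = vecMulVec u v := by
  rcases hK with ⟨y, -, rfl⟩ | ⟨x, -, rfl⟩
  · obtain ⟨u, hu⟩ := hM
    exact ⟨u, y, by ext i j; simp [hu, vecMulVec_apply]⟩
  · obtain ⟨v, hv⟩ := hM
    exact ⟨x, v, by ext i j; simp [hv, vecMulVec_apply]⟩

lemma IsRankOneSpace.eq_of_injective [Fintype F] (hm : 2 ≤ m)
    {K K' : Set (Matrix (Fin p) (Fin q) F)} (hK : IsRankOneSpace K) (hK' : IsRankOneSpace K')
    (g : (Fin m → F) → Matrix (Fin p) (Fin q) F) (hg : Function.Injective g)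
    (h : ∀ u, g u ∈ K) (h' : ∀ u, g u ∈ K') : K = K' := by
  have hcard := two_mul_card_le_card_pi (F := F) hm
  have hpos : 1 < Fintype.card F := Fintype.one_lt_card
  have hlarge {x : Fin p → F} {y : Fin q → F} (hy : y ≠ 0) (hR : ∀ u, g u ∈ Rvec y)
      (hL : ∀ u, g u ∈ Lvec x) : False := by
    have := card_le_of_injOn_line Finset.univ g hg.injOn hy (fun u _ => hR u) (fun u _ => hL u)
    rw [Finset.card_univ] at this
    omega
  obtain ⟨u, hu⟩ : ∃ u, g u ≠ 0 := by
    by_contra! hc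
    have : Subsingleton (Fin m → F) := ⟨fun a b => hg ((hc a).trans (hc b).symm)⟩
    have := Fintype.card_le_one_iff_subsingleton.2 this
    omega
  rcases hK with ⟨y, hy, rfl⟩ | ⟨x, -, rfl⟩ <;> rcases hK' with ⟨y', hy', rfl⟩ | ⟨x', -, rfl⟩
  · exact (Rvec_le_of_mem hu (h' u) (h u)).antisymm (Rvec_le_of_mem hu (h u) (h' u))
  · exact (hlarge hy h h').elim
  · exact (hlarge hy' h' h).elim
  · exact (Lvec_le_of_mem hu (h' u) (h u)).antisymm (Lvec_le_of_mem hu (h u) (h' u))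

lemma DegenerateAt.exists_isRankOneSpace [Fintype F] (hm : 2 ≤ m)
    {φ : Matrix (Fin m) (Fin n) F → Matrix (Fin p) (Fin q) F}
    (hφ : ∀ A B, Adjacent A B → Adjacent (φ A) (φ B)) {A : Matrix (Fin m) (Fin n) F}
    (hA : DegenerateAt φ A) :
    ∃ K, IsRankOneSpace K ∧ ∀ u v, φ (A + vecMulVec u v) - φ A ∈ K := by
  classical
  obtain ⟨x, hx, y, hy, h⟩ := hA
  set f : (Fin m → F) → (Fin n → F) → Matrix (Fin p) (Fin q) F :=
    fun u v => φ (A + vecMulVec u v) - φ A with hf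
  have hmem (u v) : f u v ∈ Rvec y ∨ f u v ∈ Lvec x := h _ (rowRank_vecMulVec_le_one u v)
  have hzero (v) : f 0 v = 0 := by simp [hf]
  have hadj {u u' v v'} (hne : vecMulVec u v ≠ vecMulVec u' v')
      (hrk : ∃ a b, vecMulVec u v - vecMulVec u' v' = vecMulVec a b) :
      f u v ≠ f u' v' ∧ ∃ a b, f u v - f u' v' = vecMulVec a b := by
    have := adjacent_iff.1 (hφ (A + vecMulVec u v) (A + vecMulVec u' v')
      (adjacent_iff.2 ⟨by simpa using hne, by simpa using hrk⟩))
    simpa [hf] using this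
  have hmix {u u' v v'} (hrk : ∃ a b, vecMulVec u v - vecMulVec u' v' = vecMulVec a b)
      (hR : f u v ∉ Rvec y) (hL : f u' v' ∉ Lvec x) : False := by
    by_cases hne : vecMulVec u v = vecMulVec u' v'
    · have : f u v = f u' v' := by simp [hf, hne]
      exact (hmem u v).elim hR (this ▸ hL)
    obtain ⟨-, a, b, hab⟩ := hadj hne hrk
    exact (mem_Rvec_or_mem_Lvec_of_sub_eq hx hy ((hmem u v).resolve_left hR)
      ((hmem u' v').resolve_right hL) hab).elim hR hL
  have hcol (v) : (∀ u, f u v ∈ Rvec y) ∨ ∀ u, f u v ∈ Lvec x := by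
    by_contra! hc
    obtain ⟨⟨u, hu⟩, u', hu'⟩ := hc
    exact hmix ⟨u - u', v, (sub_vecMulVec u u' v).symm⟩ hu hu'
  have hrow (u) : (∀ v, f u v ∈ Rvec y) ∨ ∀ v, f u v ∈ Lvec x := by
    by_contra! hc
    obtain ⟨⟨v, hv⟩, v', hv'⟩ := hc
    exact hmix ⟨u, v - v', (vecMulVec_sub u v v').symm⟩ hv hv'
  have hinj {v} (hv : v ≠ 0) : Function.Injective fun u => f u v := by
    intro u u' huu
    by_contra hne
    refine (hadj (u := u) (u' := u') (v := v) (v' := v) ?_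
      ⟨u - u', v, (sub_vecMulVec u u' v).symm⟩).1 huu
    intro heq
    obtain ⟨j, hj⟩ := Function.ne_iff.1 hv
    exact hne (funext fun i => mul_right_cancel₀ hj (congrFun (congrFun heq i) j))
  have h0R : (0 : Matrix (Fin p) (Fin q) F) ∈ Rvec y := ⟨0, by simp⟩
  have h0L : (0 : Matrix (Fin p) (Fin q) F) ∈ Lvec x := ⟨0, by simp⟩
  by_cases hR : ∀ v u, f u v ∈ Rvec y
  · exact ⟨_, .inl ⟨y, hy, rfl⟩, fun u v => hR v u⟩
  by_cases hL : ∀ v u, f u v ∈ Lvec x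
  · exact ⟨_, .inr ⟨x, hx, rfl⟩, fun u v => hL v u⟩
  push Not at hR hL
  obtain ⟨v₁, u₁, h₁⟩ := hR
  obtain ⟨v₂, u₂, h₂⟩ := hL
  have hv₁ : v₁ ≠ 0 := by
    rintro rfl
    exact h₁ (by simpa [hf, vecMulVec_zero_right] using h0R)
  have hv₂ : v₂ ≠ 0 := by
    rintro rfl
    exact h₂ (by simpa [hf, vecMulVec_zero_right] using h0L)
  have hL₁ := (hcol v₁).resolve_left fun hc => h₁ (hc u₁)
  have hR₂ := (hcol v₂).resolve_right fun hc => h₂ (hc u₂)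
  let s : Finset (Fin m → F) := {u | ∀ v, f u v ∈ Rvec y}
  let t : Finset (Fin m → F) := {u | ∀ v, f u v ∈ Lvec x}
  have hs : s.card ≤ Fintype.card F :=
    card_le_of_injOn_line s (fun u => f u v₁) (hinj hv₁).injOn hy
      (fun u hu => (Finset.mem_filter.1 hu).2 v₁) fun u _ => hL₁ u
  have ht : t.card ≤ Fintype.card F :=
    card_le_of_injOn_line t (fun u => f u v₂) (hinj hv₂).injOn hy
      (fun u _ => hR₂ u) fun u hu => (Finset.mem_filter.1 hu).2 v₂
  have hunion : s ∪ t = Finset.univ := by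
    ext u
    simpa [s, t] using hrow u
  have hinter : 0 < (s ∩ t).card :=
    Finset.card_pos.2 ⟨0, by simp [s, t, hzero, h0R, h0L]⟩
  have hsum := Finset.card_union_add_card_inter s t
  have hcard := two_mul_card_le_card_pi (F := F) hm
  rw [hunion, Finset.card_univ] at hsum
  omega

lemma induction_on_vecMulVec {P : Matrix (Fin m) (Fin n) F → Prop} (h0 : P 0)
    (hadd : ∀ A u v, P A → P (A + vecMulVec u v)) (A : Matrix (Fin m) (Fin n) F) : P A := by
  have hsum (s : Finset (Fin m)) : P (∑ i ∈ s, vecMulVec (Pi.single i 1) (A i)) := by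
    classical
    induction s using Finset.induction_on with
    | empty => simpa using h0
    | insert i s hi ih =>
      rw [Finset.sum_insert hi, add_comm]
      exact hadd _ _ _ ih
  convert hsum Finset.univ
  ext i j
  simp [Matrix.sum_apply, vecMulVec_apply, Pi.single_apply]

lemma exists_eq_vecMulVec_of_dim_le_one (h : m ≤ 1 ∨ n ≤ 1) (M : Matrix (Fin m) (Fin n) F) :
    ∃ u v, M = vecMulVec u v := by
  rcases h with h | h
  · have : Subsingleton (Fin m) := Fin.subsingleton_iff_le_one.2 h
    refine ⟨1, fun j => ∑ i, M i j, ?_⟩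
    ext i j
    rw [vecMulVec_apply, Fintype.sum_subsingleton _ i, Pi.one_apply, one_mul]
  · have : Subsingleton (Fin n) := Fin.subsingleton_iff_le_one.2 h
    refine ⟨fun i => ∑ j, M i j, 1, ?_⟩
    ext i j
    rw [vecMulVec_apply, Fintype.sum_subsingleton _ j, Pi.one_apply, mul_one]

end RankOne

/-- Theorem 1.3. Over a finite field, the range of a degenerate
adjacency preserver is an adjacent set. -/
theorem stmt1 {F : Type*} [Field F] [Fintype F] (m n p q : ℕ) (hm : 0 < m) (hn : 0 < n)
    (hp : 0 < p) (hq : 0 < q)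
    (φ : Matrix (Fin m) (Fin n) F → Matrix (Fin p) (Fin q) F)
    (hφ : ∀ A B, Adjacent A B → Adjacent (φ A) (φ B))
    (hdeg : Degenerate φ) :
    IsAdjacentSet (Set.range φ) := by
  by_cases hmn : m ≤ 1 ∨ n ≤ 1
  · rintro _ ⟨A, rfl⟩ _ ⟨B, rfl⟩ hne
    exact hφ A B (adjacent_iff.2
      ⟨fun h => hne (h ▸ rfl), exists_eq_vecMulVec_of_dim_le_one hmn _⟩)
  push Not at hmn
  choose K hK hmem using fun A => (hdeg A).exists_isRankOneSpace hmn.1 hφ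
  have hstep (A : Matrix (Fin m) (Fin n) F) (a : Fin m → F) (b : Fin n → F) (hb : b ≠ 0) :
      K A = K (A + vecMulVec a b) := by
    refine (hK A).eq_of_injective hmn.1 (hK _)
      (fun u => φ (A + vecMulVec u b) - φ (A + vecMulVec a b)) ?_ ?_ ?_
    · intro u u' huu
      by_contra hne
      refine (adjacent_iff.1 (hφ (A + vecMulVec u b) (A + vecMulVec u' b)
        (adjacent_iff.2 ⟨?_, u - u', b, ?_⟩))).1 (sub_left_injective huu)
      · intro heq
        obtain ⟨j, hj⟩ := Function.ne_iff.1 hb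
        exact hne (funext fun i =>
          mul_right_cancel₀ hj (add_left_cancel (congrFun (congrFun heq i) j)))
      · rw [sub_vecMulVec, add_sub_add_left_eq_sub]
    · intro u
      simpa using (hK A).sub_mem (hmem A u b) (hmem A a b)
    · intro u
      have := hmem (A + vecMulVec a b) (u - a) b
      rwa [sub_vecMulVec, add_assoc, add_sub_cancel] at this
  have hmain (A : Matrix (Fin m) (Fin n) F) : K A = K 0 ∧ φ A - φ 0 ∈ K 0 := by
    induction A using induction_on_vecMulVec with
    | h0 => exact ⟨rfl, by simpa using hmem 0 0 0⟩
    | hadd A u v ih =>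
      by_cases hv : v = 0
      · simpa [hv, vecMulVec_zero_right] using ih
      refine ⟨(hstep A u v hv).symm.trans ih.1, ?_⟩
      have h0 : φ A - φ (A + vecMulVec u v) ∈ K 0 := by
        have := hmem (A + vecMulVec u v) (-u) v
        rw [← hstep A u v hv, ih.1] at this
        simpa [neg_vecMulVec] using this
      simpa using (hK 0).sub_mem ih.2 h0
  rintro _ ⟨A, rfl⟩ _ ⟨B, rfl⟩ hne
  refine adjacent_iff.2 ⟨hne, (hK 0).exists_vecMulVec ?_⟩
  simpa using (hK 0).sub_mem (hmain A).2 (hmain B).2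
end
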